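/- arXiv:2303.17360 — 3 statements merged into one kernel-verified Lean document; each statement's English description precedes it below -/
import Mathlib

section
/- Let φ₁, φ₂ ∈ L²(𝕋) and δ > 0, K ≥ 1. Then ‖P_K(e^{it∂ₓ²}φ₁ · conj(e^{it∂ₓ²}φ₂))‖_{L²([0,δ];L²(𝕋))} ≲ ((1 + Kδ)/K)^{1/2} ‖φ₁‖_{L²} ‖φ₂‖_{L²}. -/
open MeasureTheory

instance : Fact (0 < 2 * Real.pi) := ⟨by positivity⟩

/-- The free periodic Schrödinger evolution `e^{it∂ₓ²}φ`, written in terms of the Fourier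
coefficients `c` of `φ`: its value at `(t,x)` is `Σₙ c(n) e^{-in²t} eⁱⁿˣ`. -/
noncomputable def schrodingerEvol (c : ℤ → ℂ) (t : ℝ) (x : AddCircle (2 * Real.pi)) : ℂ :=
  ∑' n : ℤ, c n * Complex.exp (-Complex.I * (n : ℂ) ^ 2 * (t : ℂ)) * fourier n x


open AddCircle

section FourierSeries

variable {T : ℝ}

/-- The sum of the Fourier series with coefficients `a`. -/
noncomputable def fourierSeries (a : ℤ → ℂ) (x : AddCircle T) : ℂ :=
  ∑' m : ℤ, a m * fourier m x

theorem norm_mul_fourier (z : ℂ) (m : ℤ) (x : AddCircle T) : ‖z * fourier m x‖ = ‖z‖ := by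
  rw [norm_mul, fourier_apply, Circle.norm_coe, mul_one]

theorem continuous_fourierSeries {a : ℤ → ℂ} (ha : Summable fun m => ‖a m‖) :
    Continuous (fourierSeries a : AddCircle T → ℂ) :=
  continuous_tsum (fun m => continuous_const.mul (fourier m).continuous) ha
    fun m x => (norm_mul_fourier (a m) m x).le

variable [hT : Fact (0 < T)]

theorem integral_fourierSeries_mul {a : ℤ → ℂ} (ha : Summable fun m => ‖a m‖)
    {g : AddCircle T → ℂ} (hg : Integrable g haarAddCircle) :
    ∫ x, fourierSeries a x * g x ∂haarAddCircle =
      ∑' m, a m * ∫ x, fourier m x * g x ∂haarAddCircle := by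
  have hint : ∀ m : ℤ, Integrable (fun x => a m * fourier m x * g x) haarAddCircle := fun m => by
    simpa [mul_assoc] using (hg.fourier_smul m).const_mul (a m)
  have hsum : Summable fun m => ∫ x, ‖a m * fourier m x * g x‖ ∂haarAddCircle := by
    simp_rw [norm_mul _ (g _), norm_mul_fourier, integral_const_mul]
    exact ha.mul_right _
  simp_rw [fourierSeries, ← tsum_mul_right]
  rw [← integral_tsum_of_summable_integral_norm hint hsum]
  simp_rw [mul_assoc, integral_const_mul]

theorem integral_fourier_haarAddCircle (n : ℤ) :
    ∫ x : AddCircle T, fourier n x ∂haarAddCircle = if n = 0 then 1 else 0 := by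
  have h := orthonormal_iff_ite.mp (orthonormal_fourier (T := T)) 0 n
  rw [fourierLp, fourierLp, ContinuousMap.inner_toLp] at h
  simpa [eq_comm] using h

theorem fourierCoeff_fourierSeries {a : ℤ → ℂ} (ha : Summable fun m => ‖a m‖) (n : ℤ) :
    fourierCoeff (fourierSeries a : AddCircle T → ℂ) n = a n := by
  simp_rw [fourierCoeff, smul_eq_mul, mul_comm (fourier (-n) _)]
  rw [integral_fourierSeries_mul ha
    ((fourier (-n)).continuous.integrable_of_hasCompactSupport (.of_compactSpace _))]
  simp_rw [← fourier_add, integral_fourier_haarAddCircle, ← sub_eq_add_neg, sub_eq_zero]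
  simp

/-- Parseval's identity for an absolutely convergent Fourier series. -/
theorem integral_norm_sq_fourierSeries {a : ℤ → ℂ} (ha : Summable fun m => ‖a m‖) :
    ∫ x : AddCircle T, ‖fourierSeries a x‖ ^ 2 = T * ∑' m, ‖a m‖ ^ 2 := by
  let f : C(AddCircle T, ℂ) := ⟨fourierSeries a, continuous_fourierSeries ha⟩
  have h := tsum_sq_fourierCoeff (f.toLp 2 haarAddCircle ℂ)
  simp_rw [fourierCoeff_toLp] at h
  have hf : ∫ x, ‖f.toLp (E := ℂ) 2 haarAddCircle ℂ x‖ ^ 2 ∂haarAddCircle =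
      ∫ x, ‖f x‖ ^ 2 ∂haarAddCircle :=
    integral_congr_ae ((ContinuousMap.coeFn_toLp (p := 2) (𝕜 := ℂ) haarAddCircle f).mono
      fun x hx => by simp only [hx])
  rw [hf, integral_haarAddCircle, smul_eq_mul] at h
  have hc : ∀ m, fourierCoeff f m = a m := fourierCoeff_fourierSeries ha
  simp_rw [hc] at h
  rw [h, mul_inv_cancel_left₀ hT.out.ne']
  rfl

/-- The Fourier coefficients of `f * conj g` are the correlations of those of `f` and `g`. -/
theorem fourierCoeff_fourierSeries_mul_conj {a b : ℤ → ℂ} (ha : Summable fun m => ‖a m‖)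
    (hb : Summable fun m => ‖b m‖) (n : ℤ) :
    fourierCoeff (fun x : AddCircle T =>
      fourierSeries a x * (starRingEnd ℂ) (fourierSeries b x)) n =
      ∑' m, a m * (starRingEnd ℂ) (b (m - n)) := by
  have hcont : Continuous fun x : AddCircle T =>
      (starRingEnd ℂ) (fourierSeries b x) * fourier (-n) x :=
    (Complex.continuous_conj.comp (continuous_fourierSeries hb)).mul (fourier (-n)).continuous
  simp_rw [fourierCoeff, smul_eq_mul, mul_comm (fourier (-n) _), mul_assoc]
  rw [integral_fourierSeries_mul ha
    (hcont.integrable_of_hasCompactSupport (.of_compactSpace _))]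
  refine tsum_congr fun m => ?_
  rw [← fourierCoeff_fourierSeries (T := T) hb (m - n), fourierCoeff, ← integral_conj]
  congr 2 with x
  rw [smul_eq_mul, map_mul, ← fourier_neg, neg_neg, sub_eq_add_neg, fourier_add]
  ring

end FourierSeries

theorem integral_comp_mul_left_le_of_pos {h : ℝ → ℝ} {T : ℝ} (hT : 0 < T)
    (hper : Function.Periodic h T) (hcont : Continuous h) (hnonneg : ∀ s, 0 ≤ h s)
    {r δ : ℝ} (hr : 0 < r) (hδ : 0 ≤ δ) :
    ∫ t in (0 : ℝ)..δ, h (r * t) ≤ (δ / T + 1 / r) * ∫ s in (0 : ℝ)..T, h s := by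
  set N : ℕ := ⌈r * δ / T⌉₊
  have hN : r * δ ≤ N * T := (div_le_iff₀ hT).mp (Nat.le_ceil _)
  have hN' : (N : ℝ) ≤ r * δ / T + 1 := (Nat.ceil_lt_add_one (by positivity)).le
  have hI : 0 ≤ ∫ s in (0 : ℝ)..T, h s :=
    intervalIntegral.integral_nonneg hT.le fun s _ => hnonneg s
  rw [intervalIntegral.integral_comp_mul_left _ hr.ne', mul_zero, smul_eq_mul]
  calc r⁻¹ * ∫ s in (0 : ℝ)..r * δ, h s
      ≤ r⁻¹ * ∫ s in (0 : ℝ)..N * T, h s := by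
        gcongr
        exact intervalIntegral.integral_mono_interval le_rfl (by positivity) hN
          (.of_forall hnonneg) (hcont.intervalIntegrable _ _)
    _ = r⁻¹ * (N * ∫ s in (0 : ℝ)..T, h s) := by
        have := hper.intervalIntegral_add_zsmul_eq N 0
          (fun _ _ => hcont.intervalIntegrable _ _)
        simp at this
        rw [this]
    _ ≤ r⁻¹ * ((r * δ / T + 1) * ∫ s in (0 : ℝ)..T, h s) := by gcongr
    _ = (δ / T + 1 / r) * ∫ s in (0 : ℝ)..T, h s := by field_simp

/-- The integral over `[0, δ]` of a nonnegative periodic function traversed at speed `r`. -/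
theorem integral_comp_mul_left_le {h : ℝ → ℝ} {T : ℝ} (hT : 0 < T)
    (hper : Function.Periodic h T) (hcont : Continuous h) (hnonneg : ∀ s, 0 ≤ h s)
    {r δ : ℝ} (hr : r ≠ 0) (hδ : 0 ≤ δ) :
    ∫ t in (0 : ℝ)..δ, h (r * t) ≤ (δ / T + 1 / |r|) * ∫ s in (0 : ℝ)..T, h s := by
  rcases hr.lt_or_gt with hr | hr
  · have hper' : Function.Periodic (fun s => h (-s)) T := fun s => by
      simp only [neg_add', hper.sub_eq]
    have key := integral_comp_mul_left_le_of_pos hT hper' (hcont.comp continuous_neg)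
      (fun s => hnonneg _) (neg_pos.mpr hr) hδ
    have hI := hper.intervalIntegral_add_eq (-T) 0
    simp only [neg_add_cancel, zero_add] at hI
    simpa [abs_of_neg hr, hI] using key
  · simpa [abs_of_pos hr] using
      integral_comp_mul_left_le_of_pos hT hper hcont hnonneg hr hδ

theorem sq_tsum_mul_le {f g : ℤ → ℝ} (hf : ∀ i, 0 ≤ f i) (hg : ∀ i, 0 ≤ g i)
    (hf' : Summable fun i => f i ^ 2) (hg' : Summable fun i => g i ^ 2) :
    (∑' i, f i * g i) ^ 2 ≤ (∑' i, f i ^ 2) * ∑' i, g i ^ 2 := by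
  have h := Real.inner_le_Lp_mul_Lq_tsum_of_nonneg (p := 2) (q := 2) (f := f) (g := g)
    Real.HolderConjugate.two_two hf hg (by simpa using hf') (by simpa using hg')
  simp only [Real.rpow_two, ← Real.sqrt_eq_rpow] at h
  have h0 : 0 ≤ ∑' i, f i * g i := tsum_nonneg fun i => mul_nonneg (hf i) (hg i)
  calc _ ≤ _ := pow_le_pow_left₀ h0 h 2
    _ = _ := by
      rw [mul_pow, Real.sq_sqrt (tsum_nonneg fun i => sq_nonneg _),
        Real.sq_sqrt (tsum_nonneg fun i => sq_nonneg _)]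

theorem summable_norm_mul_comp {a b : ℤ → ℂ} (ha : Summable fun m => ‖a m‖)
    (hb : Summable fun m => ‖b m‖) (σ : ℤ → ℤ) : Summable fun m => ‖a m‖ * ‖b (σ m)‖ :=
  (ha.mul_right (∑' k, ‖b k‖)).of_nonneg_of_le (fun _ => by positivity) fun m =>
    mul_le_mul_of_nonneg_left (hb.le_tsum (σ m) fun _ _ => norm_nonneg _) (norm_nonneg _)

theorem summable_norm_sq {c : ℤ → ℂ} (hc : Summable fun n => ‖c n‖) :
    Summable fun n => ‖c n‖ ^ 2 := by
  simpa only [sq] using summable_norm_mul_comp hc hc fun m => m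

theorem integral_norm_sq_fourierSeries_comp_mul_le {T : ℝ} [hT : Fact (0 < T)] {a : ℤ → ℂ}
    (ha : Summable fun m => ‖a m‖) {r δ : ℝ} (hr : r ≠ 0) (hδ : 0 ≤ δ) :
    ∫ t in (0 : ℝ)..δ, ‖fourierSeries a ((r * t : ℝ) : AddCircle T)‖ ^ 2 ≤
      (δ + T / |r|) * ∑' m, ‖a m‖ ^ 2 := by
  have hcont : Continuous fun s : ℝ => ‖fourierSeries a (s : AddCircle T)‖ ^ 2 :=
    ((continuous_fourierSeries ha).comp (AddCircle.continuous_mk' T)).norm.pow 2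
  have key := integral_comp_mul_left_le hT.out
    (h := fun s : ℝ => ‖fourierSeries a (s : AddCircle T)‖ ^ 2)
    (fun s => by simp only [AddCircle.coe_add_period]) hcont (fun _ => sq_nonneg _) hr hδ
  have hI := AddCircle.intervalIntegral_preimage T 0 fun x => ‖fourierSeries a x‖ ^ 2
  rw [zero_add, integral_norm_sq_fourierSeries ha] at hI
  rw [hI] at key
  refine key.trans_eq ?_
  have := hT.out.ne'
  field_simp

/-- The summands of the `n`-th coefficient of the correlation of `c₁` and `c₂`. -/
noncomputable def correlationTerm (c₁ c₂ : ℤ → ℂ) (n m : ℤ) : ℂ :=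
  c₁ m * (starRingEnd ℂ) (c₂ (m - n))

theorem norm_correlationTerm (c₁ c₂ : ℤ → ℂ) (n m : ℤ) :
    ‖correlationTerm c₁ c₂ n m‖ = ‖c₁ m‖ * ‖c₂ (m - n)‖ := by
  rw [correlationTerm, norm_mul, RCLike.norm_conj]

theorem summable_norm_correlationTerm {c₁ c₂ : ℤ → ℂ} (h₁ : Summable fun n => ‖c₁ n‖)
    (h₂ : Summable fun n => ‖c₂ n‖) (n : ℤ) :
    Summable fun m => ‖correlationTerm c₁ c₂ n m‖ := by
  simp_rw [norm_correlationTerm]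
  exact summable_norm_mul_comp h₁ h₂ (· - n)

theorem sum_tsum_norm_sq_correlationTerm_le {c₁ c₂ : ℤ → ℂ} (h₁ : Summable fun n => ‖c₁ n‖)
    (h₂ : Summable fun n => ‖c₂ n‖) (S : Finset ℤ) :
    ∑ n ∈ S, ∑' m, ‖correlationTerm c₁ c₂ n m‖ ^ 2 ≤
      (∑' n, ‖c₁ n‖ ^ 2) * ∑' n, ‖c₂ n‖ ^ 2 := by
  have hs n := summable_norm_sq (summable_norm_correlationTerm h₁ h₂ n)
  rw [← Summable.tsum_finsetSum fun n _ => hs n, ← tsum_mul_right]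
  refine (summable_sum fun n _ => hs n).tsum_le_tsum (fun m => ?_)
    ((summable_norm_sq h₁).mul_right _)
  simp_rw [norm_correlationTerm, mul_pow, ← Finset.mul_sum]
  gcongr
  rw [← (Equiv.subLeft m).tsum_eq fun n => ‖c₂ n‖ ^ 2]
  exact ((Equiv.subLeft m).summable_iff.mpr (summable_norm_sq h₂)).sum_le_tsum S
    fun _ _ => sq_nonneg _

theorem norm_exp_phase (k t : ℝ) : ‖Complex.exp (-Complex.I * (k : ℂ) ^ 2 * (t : ℂ))‖ = 1 := by
  rw [show -Complex.I * (k : ℂ) ^ 2 * (t : ℂ) = ((-k ^ 2 * t : ℝ) : ℂ) * Complex.I by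
    push_cast; ring, Complex.norm_exp_ofReal_mul_I]

theorem norm_fourierCoeff_schrodingerEvol_mul_conj {c₁ c₂ : ℤ → ℂ}
    (h₁ : Summable fun n => ‖c₁ n‖) (h₂ : Summable fun n => ‖c₂ n‖) (t : ℝ) (n : ℤ) :
    ‖fourierCoeff (fun y => schrodingerEvol c₁ t y *
      (starRingEnd ℂ) (schrodingerEvol c₂ t y)) n‖ =
      ‖fourierSeries (correlationTerm c₁ c₂ n)
        ((-2 * n * t : ℝ) : AddCircle (2 * Real.pi))‖ := by
  have hs {c : ℤ → ℂ} (hc : Summable fun n => ‖c n‖) :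
      Summable fun m : ℤ => ‖c m * Complex.exp (-Complex.I * (m : ℂ) ^ 2 * (t : ℂ))‖ :=
    hc.congr fun m => by
      rw [norm_mul, ← Complex.ofReal_intCast, norm_exp_phase, mul_one]
  have key := fourierCoeff_fourierSeries_mul_conj (T := 2 * Real.pi) (hs h₁) (hs h₂) n
  have hphase : ∑' m : ℤ, c₁ m * Complex.exp (-Complex.I * (m : ℂ) ^ 2 * (t : ℂ)) *
      (starRingEnd ℂ) (c₂ (m - n) *
        Complex.exp (-Complex.I * ((m - n : ℤ) : ℂ) ^ 2 * (t : ℂ))) =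
      (starRingEnd ℂ) (Complex.exp (-Complex.I * (n : ℂ) ^ 2 * (t : ℂ))) *
        fourierSeries (correlationTerm c₁ c₂ n)
          ((-2 * n * t : ℝ) : AddCircle (2 * Real.pi)) := by
    rw [fourierSeries, ← tsum_mul_left]
    refine tsum_congr fun m => ?_
    have hexp : Complex.exp (-Complex.I * (m : ℂ) ^ 2 * (t : ℂ)) *
        (starRingEnd ℂ) (Complex.exp (-Complex.I * ((m - n : ℤ) : ℂ) ^ 2 * (t : ℂ))) =
        (starRingEnd ℂ) (Complex.exp (-Complex.I * (n : ℂ) ^ 2 * (t : ℂ))) *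
          fourier m ((-2 * n * t : ℝ) : AddCircle (2 * Real.pi)) := by
      rw [fourier_coe_apply, ← Complex.exp_conj, ← Complex.exp_conj, ← Complex.exp_add,
        ← Complex.exp_add]
      congr 1
      simp only [map_mul, map_neg, map_pow, Complex.conj_I, Complex.conj_ofReal, map_intCast]
      have := Real.pi_ne_zero
      push_cast
      field_simp
      ring
    rw [correlationTerm, map_mul]
    linear_combination (c₁ m * (starRingEnd ℂ) (c₂ (m - n))) * hexp
  rw [hphase] at key
  change ‖fourierCoeff (fun y => fourierSeries _ y * (starRingEnd ℂ) (fourierSeries _ y)) n‖ = _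
  rw [key, norm_mul, RCLike.norm_conj, ← Complex.ofReal_intCast, norm_exp_phase, one_mul]

theorem norm_sq_fourierSeries_correlationTerm_zero_le {c₁ c₂ : ℤ → ℂ}
    (h₁ : Summable fun n => ‖c₁ n‖) (h₂ : Summable fun n => ‖c₂ n‖) {T : ℝ} (x : AddCircle T) :
    ‖fourierSeries (correlationTerm c₁ c₂ 0) x‖ ^ 2 ≤
      (∑' n, ‖c₁ n‖ ^ 2) * ∑' n, ‖c₂ n‖ ^ 2 := by
  have hs := summable_norm_correlationTerm h₁ h₂ 0
  have hle : ‖fourierSeries (correlationTerm c₁ c₂ 0) x‖ ≤ ∑' m, ‖c₁ m‖ * ‖c₂ m‖ := by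
    refine (norm_tsum_le_tsum_norm (by simpa only [norm_mul_fourier] using hs)).trans_eq ?_
    simp_rw [norm_mul_fourier, norm_correlationTerm, sub_zero]
  exact (pow_le_pow_left₀ (norm_nonneg _) hle 2).trans
    (sq_tsum_mul_le (fun _ => norm_nonneg _) (fun _ => norm_nonneg _)
      (summable_norm_sq h₁) (summable_norm_sq h₂))

/-- The contribution of a single output frequency `n` to the bilinear estimate. -/
theorem integral_norm_sq_fourierSeries_correlationTerm_le {c₁ c₂ : ℤ → ℂ}
    (h₁ : Summable fun n => ‖c₁ n‖) (h₂ : Summable fun n => ‖c₂ n‖) {K δ : ℝ} (hK : 0 < K)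
    (hδ : 0 ≤ δ) {n : ℤ} (hn : n = 0 ∨ K / 2 ≤ |(n : ℝ)|) :
    ∫ t in (0 : ℝ)..δ, ‖fourierSeries (correlationTerm c₁ c₂ n)
        ((-2 * n * t : ℝ) : AddCircle (2 * Real.pi))‖ ^ 2 ≤
      (δ + 2 * Real.pi / K) * ∑' m, ‖correlationTerm c₁ c₂ n m‖ ^ 2 +
        if n = 0 then δ * ((∑' n, ‖c₁ n‖ ^ 2) * ∑' n, ‖c₂ n‖ ^ 2) else 0 := by
  have hB : 0 ≤ ∑' m, ‖correlationTerm c₁ c₂ n m‖ ^ 2 := tsum_nonneg fun _ => sq_nonneg _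
  rcases eq_or_ne n 0 with rfl | hn0
  · have hpos : 0 ≤ (δ + 2 * Real.pi / K) * ∑' m, ‖correlationTerm c₁ c₂ 0 m‖ ^ 2 := by
      positivity
    have h0 := norm_sq_fourierSeries_correlationTerm_zero_le h₁ h₂ (0 : AddCircle (2 * Real.pi))
    simp only [Int.cast_zero, mul_zero, zero_mul, QuotientAddGroup.mk_zero,
      intervalIntegral.integral_const, sub_zero, smul_eq_mul, if_true]
    exact (mul_le_mul_of_nonneg_left h0 hδ).trans (le_add_of_nonneg_left hpos)
  · have hn' : K / 2 ≤ |(n : ℝ)| := hn.resolve_left hn0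
    rw [if_neg hn0, add_zero]
    refine (integral_norm_sq_fourierSeries_comp_mul_le
      (summable_norm_correlationTerm h₁ h₂ n) (by simpa using hn0) hδ).trans ?_
    have habs : K ≤ |(-2 * n : ℝ)| := by
      rw [abs_mul, abs_neg, abs_two]; linarith
    gcongr

/-- Short-time bilinear Strichartz estimate on the torus:
`‖P_K(e^{it∂ₓ²}φ₁ conj(e^{it∂ₓ²}φ₂))‖_{L²([0,δ];L²(𝕋))} ≲ ((1+Kδ)/K)^{1/2}‖φ₁‖_{L²}‖φ₂‖_{L²}`
(squared form, with `φⱼ` given by absolutely summable Fourier coefficients `cⱼ`). -/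
theorem stmt12 :
    ∃ C > (0:ℝ), ∀ (K : ℝ), 1 ≤ K → ∀ (ψ : ℤ → ℂ),
      (∀ n : ℤ, ψ n ≠ 0 → |(n : ℝ)| ≤ 2 * K ∧ (K ≤ 1 ∨ K / 2 ≤ |(n : ℝ)|)) →
      (∀ n, ‖ψ n‖ ≤ 1) →
      ∀ δ : ℝ, 0 < δ →
      ∀ c₁ c₂ : ℤ → ℂ, Summable (fun n => ‖c₁ n‖) → Summable (fun n => ‖c₂ n‖) →
      (∫ t in (0:ℝ)..δ, ∫ x : AddCircle (2 * Real.pi),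
          ‖∑' n : ℤ, ψ n *
            fourierCoeff (fun y => schrodingerEvol c₁ t y *
              (starRingEnd ℂ) (schrodingerEvol c₂ t y)) n * fourier n x‖ ^ 2)
        ≤ C * ((1 + K * δ) / K) * (∑' n : ℤ, ‖c₁ n‖ ^ 2) * (∑' n : ℤ, ‖c₂ n‖ ^ 2) := by
  refine ⟨2 * Real.pi * (2 * Real.pi), by positivity, ?_⟩
  intro K hK ψ hψ hψ1 δ hδ c₁ c₂ h₁ h₂
  have hK0 : 0 < K := by linarith
  set X : ℝ := (∑' n, ‖c₁ n‖ ^ 2) * ∑' n, ‖c₂ n‖ ^ 2 with hX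
  have hX0 : 0 ≤ X := mul_nonneg (tsum_nonneg fun _ => sq_nonneg _)
    (tsum_nonneg fun _ => sq_nonneg _)
  obtain ⟨S, hS⟩ : ∃ S : Finset ℤ, ∀ n ∉ S, ψ n = 0 := by
    refine ⟨Finset.Icc (-⌈2 * K⌉) ⌈2 * K⌉, fun n hn => ?_⟩
    contrapose! hn
    have h := abs_le.mp ((hψ n hn).1.trans (Int.le_ceil _))
    exact Finset.mem_Icc.mpr ⟨by exact_mod_cast h.1, by exact_mod_cast h.2⟩
  have hfreq : ∀ n, ψ n ≠ 0 → n = 0 ∨ K / 2 ≤ |(n : ℝ)| := fun n hn => by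
    rcases (hψ n hn).2 with hK1 | h
    · refine or_iff_not_imp_left.mpr fun hn0 => ?_
      have : (1 : ℝ) ≤ |(n : ℝ)| := by exact_mod_cast Int.one_le_abs hn0
      linarith
    · exact .inr h
  let G : ℤ → ℝ → ℝ := fun n t => ‖fourierSeries (correlationTerm c₁ c₂ n)
    ((-2 * n * t : ℝ) : AddCircle (2 * Real.pi))‖ ^ 2
  have hG : ∀ n, Continuous (G n) := fun n =>
    (((continuous_fourierSeries (summable_norm_correlationTerm h₁ h₂ n)).comp
      (AddCircle.continuous_mk' _)).comp (by fun_prop)).norm.pow 2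
  have hspace : ∀ t : ℝ, (∫ x : AddCircle (2 * Real.pi), ‖∑' n : ℤ, ψ n *
      fourierCoeff (fun y => schrodingerEvol c₁ t y *
        (starRingEnd ℂ) (schrodingerEvol c₂ t y)) n * fourier n x‖ ^ 2) =
      2 * Real.pi * ∑ n ∈ S, ‖ψ n‖ ^ 2 * G n t := fun t => by
    refine (integral_norm_sq_fourierSeries (summable_of_ne_finset_zero (s := S) fun n hn => by
      simp [hS n hn])).trans ?_
    rw [tsum_eq_sum (s := S) fun n hn => by simp [hS n hn]]
    simp_rw [norm_mul, mul_pow, norm_fourierCoeff_schrodingerEvol_mul_conj h₁ h₂, G]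
  have hterm : ∀ n, ‖ψ n‖ ^ 2 * ∫ t in (0 : ℝ)..δ, G n t ≤
      (δ + 2 * Real.pi / K) * ∑' m, ‖correlationTerm c₁ c₂ n m‖ ^ 2 +
        if n = 0 then δ * X else 0 := fun n => by
    have hB : 0 ≤ ∑' m, ‖correlationTerm c₁ c₂ n m‖ ^ 2 := tsum_nonneg fun _ => sq_nonneg _
    by_cases hn : ψ n = 0
    · rw [hn, norm_zero, zero_pow two_ne_zero, zero_mul]
      have : 0 ≤ if n = 0 then δ * X else 0 := by split_ifs <;> positivity
      positivity
    · refine le_trans (mul_le_of_le_one_left ?_ (pow_le_one₀ (norm_nonneg _) (hψ1 n)))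
        (integral_norm_sq_fourierSeries_correlationTerm_le h₁ h₂ hK0 hδ.le (hfreq n hn))
      exact intervalIntegral.integral_nonneg hδ.le fun t _ => sq_nonneg _
  have hsum : ∑ n ∈ S, ‖ψ n‖ ^ 2 * ∫ t in (0 : ℝ)..δ, G n t ≤
      (δ + 2 * Real.pi / K) * X + δ * X := by
    refine (Finset.sum_le_sum fun n _ => hterm n).trans ?_
    rw [Finset.sum_add_distrib, ← Finset.mul_sum, Finset.sum_ite_eq']
    gcongr
    · exact sum_tsum_norm_sq_correlationTerm_le h₁ h₂ S
    · split_ifs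
      · exact le_rfl
      · positivity
  simp_rw [hspace]
  rw [intervalIntegral.integral_const_mul, intervalIntegral.integral_finsetSum fun n _ =>
    ((hG n).const_mul (‖ψ n‖ ^ 2)).intervalIntegrable _ _]
  simp_rw [intervalIntegral.integral_const_mul]
  rw [mul_assoc _ (∑' n, ‖c₁ n‖ ^ 2), ← hX, mul_assoc (2 * Real.pi), mul_assoc (2 * Real.pi)]
  gcongr
  refine hsum.trans ?_
  rw [← add_mul]
  gcongr
  have hpi : δ * 2 ≤ δ * (2 * Real.pi) := by
    gcongr
    linarith [Real.pi_gt_three]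
  have : 2 * Real.pi * ((1 + K * δ) / K) = 2 * Real.pi / K + δ * (2 * Real.pi) := by
    field_simp
  linarith
end

section
/- Let N₁ ≫ N₂, N₃ be dyadic, φⱼ ∈ L²(𝕋) with Fourier support in the dyadic annulus of size N_j, and 0 < δ ≲ N₁⁻¹. Then ‖e^{it∂ₓ²}φ₁ · H(e^{it∂ₓ²}φ₂ · conj(e^{it∂ₓ²}φ₃))‖_{L²([0,δ];L²(𝕋))} ≲ (min(N₂,N₃)/N₁)^{1/2} ‖φ₁‖_{L²} ‖φ₂‖_{L²} ‖φ₃‖_{L²}. -/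
open MeasureTheory

/-- The Hilbert transform on the torus: Fourier multiplier with symbol `-i sgn(n)`,
applied to a function `f`. -/
noncomputable def hilbertT (f : AddCircle (2 * Real.pi) → ℂ) (x : AddCircle (2 * Real.pi)) : ℂ :=
  ∑' n : ℤ, (-Complex.I * ((Int.sign n : ℤ) : ℂ)) * fourierCoeff f n * fourier n x

open Finset ComplexConjugate

/-- Orthogonality of the characters of the circle. -/
theorem fourierCoeff_fourier_eq_ite {T : ℝ} [Fact (0 < T)] (k n : ℤ) :
    fourierCoeff (fun x : AddCircle T => fourier k x) n = if k = n then 1 else 0 := by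
  have h := orthonormal_iff_ite.mp (@orthonormal_fourier T _) n k
  rw [ContinuousMap.inner_toLp (@AddCircle.haarAddCircle T _) (fourier n) (fourier k)] at h
  simp only [eq_comm (a := k)]
  rw [← h, fourierCoeff]
  refine integral_congr_ae (.of_forall fun x => ?_)
  simp only [smul_eq_mul, fourier_neg]
  ring

/-- The `n`-th Fourier coefficient of a trigonometric polynomial. -/
theorem fourierCoeff_sum_mul_fourier {ι : Type*} {T : ℝ} [Fact (0 < T)] (s : Finset ι)
    (a : ι → ℂ) (g : ι → ℤ) (n : ℤ) :
    fourierCoeff (fun x : AddCircle T => ∑ i ∈ s, a i * fourier (g i) x) n =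
      ∑ i ∈ s, if g i = n then a i else 0 := by
  have h := fourierCoeff.sum s (fun i (x : AddCircle T) => a i * fourier (g i) x)
    (fun i _ => (Continuous.integrable_of_hasCompactSupport (by fun_prop)
      (HasCompactSupport.of_compactSpace _)))
  have h2 : (∑ i ∈ s, fun x : AddCircle T => a i * fourier (g i) x) =
      fun x : AddCircle T => ∑ i ∈ s, a i * fourier (g i) x := by
    ext x; simp only [Finset.sum_apply]
  rw [h2] at h
  rw [h, Finset.sum_apply]
  refine Finset.sum_congr rfl fun i _ => ?_
  rw [fourierCoeff.const_mul, fourierCoeff_fourier_eq_ite, mul_ite, mul_one, mul_zero]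

/-- Parseval's identity for trigonometric polynomials. -/
theorem integral_norm_sq_sum_mul_fourier {ι : Type*} {T : ℝ} [hT : Fact (0 < T)] (s : Finset ι)
    (a : ι → ℂ) (g : ι → ℤ) (hg : Set.InjOn g s) :
    ∫ x : AddCircle T, ‖∑ i ∈ s, a i * fourier (g i) x‖ ^ 2 = T * ∑ i ∈ s, ‖a i‖ ^ 2 := by
  classical
  have key : ∫ x : AddCircle T, ‖∑ i ∈ s, a i * fourier (g i) x‖ ^ 2 ∂AddCircle.haarAddCircle =
      ∑ i ∈ s, ‖a i‖ ^ 2 := by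
    apply Complex.ofReal_injective
    rw [← integral_complex_ofReal]
    have h1 : ∀ x : AddCircle T, ((‖∑ i ∈ s, a i * fourier (g i) x‖ ^ 2 : ℝ) : ℂ) =
        ∑ j ∈ s, conj (a j) *
          (fourier (-g j) x • ∑ i ∈ s, a i * fourier (g i) x) := by
      intro x
      push_cast
      rw [← Complex.conj_mul', map_sum, Finset.sum_mul]
      refine Finset.sum_congr rfl fun j _ => ?_
      rw [map_mul, fourier_neg, smul_eq_mul, mul_assoc]
    simp_rw [h1]
    rw [integral_finsetSum _ fun j _ => Continuous.integrable_of_hasCompactSupport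
      (by fun_prop) (HasCompactSupport.of_compactSpace _)]
    push_cast
    refine Finset.sum_congr rfl fun j hj => ?_
    rw [integral_const_mul]
    have h3 := fourierCoeff_sum_mul_fourier (T := T) s a g (g j)
    rw [fourierCoeff] at h3
    rw [h3, ← Complex.conj_mul']
    congr 1
    rw [Finset.sum_eq_single_of_mem j hj, if_pos rfl]
    intro i hi hij
    exact if_neg fun h => hij (hg hi hj h)
  rw [AddCircle.integral_haarAddCircle, smul_eq_mul] at key
  rw [← key, mul_inv_cancel_left₀ hT.out.ne']

/-- An exponential sum whose frequencies are distinct multiples of `2m` has the expected mean square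
over an interval no longer than its period `π / |m|`. -/
theorem intervalIntegral_norm_sq_exp_sum_le (s : Finset ℤ) (b : ℤ → ℂ) {m : ℤ} (hm : m ≠ 0)
    {δ : ℝ} (hδ : 0 ≤ δ) (hδm : δ ≤ Real.pi / |(m : ℝ)|) :
    ∫ t in (0:ℝ)..δ, ‖∑ k ∈ s, b k * Complex.exp (2 * Complex.I * m * k * t)‖ ^ 2 ≤
      Real.pi / |(m : ℝ)| * ∑ k ∈ s, ‖b k‖ ^ 2 := by
  have hm' : (m : ℝ) ≠ 0 := by exact_mod_cast hm
  have hT : 0 < Real.pi / |(m : ℝ)| := by positivity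
  have : Fact (0 < Real.pi / |(m : ℝ)|) := ⟨hT⟩
  have hcont : Continuous fun t : ℝ =>
      ‖∑ k ∈ s, b k * Complex.exp (2 * Complex.I * m * k * t)‖ ^ 2 := by fun_prop
  have hg : Set.InjOn (fun k : ℤ => m.sign * k) s := by
    intro k _ l _ h
    exact mul_left_cancel₀ (by simpa using hm) h
  rw [← integral_norm_sq_sum_mul_fourier (T := Real.pi / |(m : ℝ)|) s b _ hg,
    ← AddCircle.intervalIntegral_preimage _ 0, zero_add]
  have hfou : ∀ (k : ℤ) (t : ℝ), Complex.exp (2 * Complex.I * m * k * t) =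
      fourier (m.sign * k) (t : AddCircle (Real.pi / |(m : ℝ)|)) := by
    intro k t
    rw [fourier_coe_apply]
    congr 1
    have h1 : (m : ℂ) = (m.sign : ℂ) * ((|(m : ℝ)| : ℝ) : ℂ) := by
      rw [← Int.cast_abs]
      exact_mod_cast (Int.sign_mul_abs m).symm
    have h2 : ((|(m : ℝ)| : ℝ) : ℂ) ≠ 0 := by exact_mod_cast abs_ne_zero.mpr hm'
    have h3 : (Real.pi : ℂ) ≠ 0 := by exact_mod_cast Real.pi_ne_zero
    rw [h1]
    push_cast
    field_simp
  simp_rw [hfou] at hcont ⊢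
  exact intervalIntegral.integral_mono_interval le_rfl hδ hδm
    (.of_forall fun t => by positivity) (hcont.intervalIntegrable _ _)

/-- Re-indexing a sum over `n ∈ s` by the difference `n - k`. -/
theorem sum_eq_sum_image_sub {M : Type*} [AddCommMonoid M] (s u : Finset ℤ) (f : ℤ → M)
    (hf : ∀ n ∉ s, f n = 0) {k : ℤ} (hk : k ∈ u) :
    ∑ n ∈ s, f n = ∑ m ∈ (s ×ˢ u).image (fun p : ℤ × ℤ => p.1 - p.2), f (m + k) := by
  refine Finset.sum_of_injOn (fun n => n - k) (fun a _ b _ h => by simpa using h) ?_ ?_ ?_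
  · intro n hn
    simp only [Finset.coe_image, Set.mem_image, Finset.mem_coe, Finset.mem_product]
    exact ⟨(n, k), ⟨hn, hk⟩, rfl⟩
  · intro m _ hm
    refine hf _ fun h => hm ⟨m + k, h, by simp⟩
  · intro n _
    simp

theorem norm_exp_neg_I_mul_sq_mul (n : ℤ) (t : ℝ) :
    ‖Complex.exp (-Complex.I * (n : ℂ) ^ 2 * t)‖ = 1 := by
  rw [show -Complex.I * (n : ℂ) ^ 2 * t = ((-(n : ℝ) ^ 2 * t : ℝ) : ℂ) * Complex.I by
    push_cast; ring, Complex.norm_exp_ofReal_mul_I]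

theorem schrodingerEvol_eq_sum {c : ℤ → ℂ} {s : Finset ℤ} (hc : ∀ n ∉ s, c n = 0) (t : ℝ)
    (x : AddCircle (2 * Real.pi)) :
    schrodingerEvol c t x =
      ∑ n ∈ s, c n * Complex.exp (-Complex.I * (n : ℂ) ^ 2 * (t : ℂ)) * fourier n x :=
  tsum_eq_sum fun n hn => by simp [hc n hn]

/-- The product `e^{it∂ₓ²}φ · conj(e^{it∂ₓ²}ψ)` grouped by spatial frequency. -/
theorem schrodingerEvol_mul_conj_eq_sum {c d : ℤ → ℂ} {s u : Finset ℤ} (hc : ∀ n ∉ s, c n = 0)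
    (hd : ∀ n ∉ u, d n = 0) (t : ℝ) (x : AddCircle (2 * Real.pi)) :
    schrodingerEvol c t x * conj (schrodingerEvol d t x) =
      ∑ m ∈ (s ×ˢ u).image (fun p : ℤ × ℤ => p.1 - p.2),
        (Complex.exp (-Complex.I * (m : ℂ) ^ 2 * t) * ∑ k ∈ u, c (m + k) * conj (d k) *
          Complex.exp (2 * Complex.I * ((-m : ℤ) : ℂ) * k * t)) * fourier m x := by
  rw [schrodingerEvol_eq_sum hc, schrodingerEvol_eq_sum hd, map_sum, Finset.mul_sum]
  simp_rw [Finset.mul_sum, Finset.sum_mul]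
  conv_rhs => rw [Finset.sum_comm]
  refine Finset.sum_congr rfl fun k hk => ?_
  rw [sum_eq_sum_image_sub s u _ (fun n hn => by simp [hc n hn]) hk]
  refine Finset.sum_congr rfl fun m _ => ?_
  rw [fourier_add, map_mul, map_mul, ← Complex.exp_conj]
  have h1 : (fourier k x : ℂ) * conj (fourier k x : ℂ) = 1 := by
    rw [← fourier_neg, ← fourier_add, add_neg_cancel, fourier_zero]
  have h2 : Complex.exp (-Complex.I * ((m + k : ℤ) : ℂ) ^ 2 * t) *
      Complex.exp (conj (-Complex.I * (k : ℂ) ^ 2 * (t : ℂ))) =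
      Complex.exp (-Complex.I * (m : ℂ) ^ 2 * t) *
        Complex.exp (2 * Complex.I * ((-m : ℤ) : ℂ) * k * t) := by
    rw [← Complex.exp_add, ← Complex.exp_add]
    congr 1
    simp only [map_mul, map_neg, map_pow, Complex.conj_I, Complex.conj_ofReal,
      map_intCast]
    push_cast
    ring
  linear_combination (c (m + k) * conj (d k) * fourier m x *
    Complex.exp (-Complex.I * ((m + k : ℤ) : ℂ) ^ 2 * t) *
      Complex.exp (conj (-Complex.I * (k : ℂ) ^ 2 * (t : ℂ)))) * h1 +
    (c (m + k) * conj (d k) * fourier m x) * h2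

/-- Spatial Parseval identity for `e^{it∂ₓ²}φ · conj(e^{it∂ₓ²}ψ)`. -/
theorem integral_norm_sq_schrodingerEvol_mul_conj {c d : ℤ → ℂ} {s u : Finset ℤ}
    (hc : ∀ n ∉ s, c n = 0) (hd : ∀ n ∉ u, d n = 0) (t : ℝ) :
    ∫ x, ‖schrodingerEvol c t x * conj (schrodingerEvol d t x)‖ ^ 2 =
      2 * Real.pi * ∑ m ∈ (s ×ˢ u).image (fun p : ℤ × ℤ => p.1 - p.2),
        ‖∑ k ∈ u, c (m + k) * conj (d k) *
          Complex.exp (2 * Complex.I * ((-m : ℤ) : ℂ) * k * t)‖ ^ 2 := by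
  simp_rw [schrodingerEvol_mul_conj_eq_sum hc hd]
  rw [integral_norm_sq_sum_mul_fourier _ _ (fun m => m) (fun _ _ _ _ h => h)]
  congr 1
  refine Finset.sum_congr rfl fun m _ => ?_
  rw [norm_mul, norm_exp_neg_I_mul_sq_mul, one_mul]

theorem continuous_integral_norm_sq_schrodingerEvol_mul_conj {c d : ℤ → ℂ} {s u : Finset ℤ}
    (hc : ∀ n ∉ s, c n = 0) (hd : ∀ n ∉ u, d n = 0) :
    Continuous fun t : ℝ => ∫ x, ‖schrodingerEvol c t x * conj (schrodingerEvol d t x)‖ ^ 2 := by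
  simp_rw [integral_norm_sq_schrodingerEvol_mul_conj hc hd]
  fun_prop

/-- Bilinear estimate for frequencies whose differences have size comparable to `N`. -/
theorem integral_norm_sq_schrodingerEvol_mul_conj_le {c d : ℤ → ℂ} {s u : Finset ℤ}
    (hc : ∀ n ∉ s, c n = 0) (hd : ∀ n ∉ u, d n = 0) {N δ : ℝ} (hN : 0 < N)
    (hlow : ∀ n ∈ s, ∀ k ∈ u, N / 4 ≤ |((n - k : ℤ) : ℝ)|)
    (hup : ∀ n ∈ s, ∀ k ∈ u, |((n - k : ℤ) : ℝ)| ≤ 3 * N) (hδ : 0 ≤ δ) (hδN : δ ≤ N⁻¹) :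
    ∫ t in (0:ℝ)..δ, ∫ x, ‖schrodingerEvol c t x * conj (schrodingerEvol d t x)‖ ^ 2 ≤
      8 * Real.pi ^ 2 / N * (∑ n ∈ s, ‖c n‖ ^ 2) * ∑ k ∈ u, ‖d k‖ ^ 2 := by
  simp_rw [integral_norm_sq_schrodingerEvol_mul_conj hc hd]
  rw [intervalIntegral.integral_const_mul, intervalIntegral.integral_finsetSum
    fun m _ => Continuous.intervalIntegrable (by fun_prop) _ _]
  have hterm : ∀ m ∈ (s ×ˢ u).image (fun p : ℤ × ℤ => p.1 - p.2),
      ∫ t in (0:ℝ)..δ, ‖∑ k ∈ u, c (m + k) * conj (d k) *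
          Complex.exp (2 * Complex.I * ((-m : ℤ) : ℂ) * k * t)‖ ^ 2 ≤
        4 * Real.pi / N * ∑ k ∈ u, ‖c (m + k)‖ ^ 2 * ‖d k‖ ^ 2 := by
    intro m hm
    obtain ⟨⟨n, k⟩, hp, rfl⟩ := Finset.mem_image.mp hm
    obtain ⟨hn, hk⟩ := Finset.mem_product.mp hp
    have h1 := hlow n hn k hk
    have h2 := hup n hn k hk
    simp only
    generalize n - k = m at *
    have hmpos : 0 < |(m : ℝ)| := by linarith
    have hm0 : -m ≠ 0 := by
      rintro h
      simp [neg_eq_zero.mp h] at hmpos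
    have habs : |((-m : ℤ) : ℝ)| = |(m : ℝ)| := by push_cast; exact abs_neg _
    have h3 := intervalIntegral_norm_sq_exp_sum_le u (fun k => c (m + k) * conj (d k)) hm0 hδ
      (by
        rw [habs, le_div_iff₀ hmpos]
        calc δ * |(m : ℝ)| ≤ N⁻¹ * (3 * N) := by gcongr
          _ = 3 := by field_simp
          _ ≤ Real.pi := Real.pi_gt_three.le)
    refine h3.trans ?_
    rw [habs]
    have h4 : Real.pi / |(m : ℝ)| ≤ 4 * Real.pi / N := by
      rw [div_le_div_iff₀ hmpos hN]
      nlinarith [Real.pi_pos]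
    simp only [norm_mul, RCLike.norm_conj, mul_pow]
    gcongr
  calc _ ≤ 2 * Real.pi * ∑ m ∈ (s ×ˢ u).image (fun p : ℤ × ℤ => p.1 - p.2),
        4 * Real.pi / N * ∑ k ∈ u, ‖c (m + k)‖ ^ 2 * ‖d k‖ ^ 2 := by
        gcongr with m hm; exact hterm m hm
    _ = 8 * Real.pi ^ 2 / N * ∑ k ∈ u, ∑ m ∈ (s ×ˢ u).image (fun p : ℤ × ℤ => p.1 - p.2),
          ‖c (m + k)‖ ^ 2 * ‖d k‖ ^ 2 := by
        rw [← Finset.mul_sum, Finset.sum_comm]; ring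
    _ = 8 * Real.pi ^ 2 / N * ∑ k ∈ u, (∑ n ∈ s, ‖c n‖ ^ 2) * ‖d k‖ ^ 2 := by
        congr 1
        refine Finset.sum_congr rfl fun k hk => ?_
        rw [← Finset.sum_mul,
          ← sum_eq_sum_image_sub s u (fun n => ‖c n‖ ^ 2) (fun n hn => by simp [hc n hn]) hk]
    _ = _ := by rw [← Finset.mul_sum]; ring

/-- The Hilbert transform of a trigonometric polynomial. -/
theorem hilbertT_sum_mul_fourier {ι : Type*} (s : Finset ι) (a : ι → ℂ) (g : ι → ℤ)
    (x : AddCircle (2 * Real.pi)) :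
    hilbertT (fun y => ∑ i ∈ s, a i * fourier (g i) y) x =
      ∑ i ∈ s, (-Complex.I * ((Int.sign (g i) : ℤ) : ℂ)) * a i * fourier (g i) x := by
  have h : ∀ n : ℤ, (-Complex.I * ((Int.sign n : ℤ) : ℂ)) *
      (∑ i ∈ s, if g i = n then a i else 0) * fourier n x =
      ∑ i ∈ s, if n = g i then
        (-Complex.I * ((Int.sign (g i) : ℤ) : ℂ)) * a i * fourier (g i) x else 0 := by
    intro n
    rw [Finset.mul_sum, Finset.sum_mul]
    refine Finset.sum_congr rfl fun i _ => ?_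
    rcases eq_or_ne n (g i) with rfl | hn
    · simp
    · simp [hn, hn.symm]
  simp_rw [hilbertT, fourierCoeff_sum_mul_fourier, h]
  rw [Summable.tsum_finsetSum fun i _ => (hasSum_ite_eq (g i) _).summable]
  exact Finset.sum_congr rfl fun i _ => tsum_ite_eq _ _

/-- The Hilbert transform commutes with complex conjugation. -/
theorem conj_hilbertT (f : AddCircle (2 * Real.pi) → ℂ) (x : AddCircle (2 * Real.pi)) :
    conj (hilbertT f x) = hilbertT (fun y => conj (f y)) x := by
  have hcoeff : ∀ n : ℤ, conj (fourierCoeff f (-n)) = fourierCoeff (fun y => conj (f y)) n := by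
    intro n
    rw [fourierCoeff, fourierCoeff, ← integral_conj]
    refine integral_congr_ae (.of_forall fun y => ?_)
    simp only [smul_eq_mul, map_mul]
    rw [← fourier_neg, neg_neg]
  rw [hilbertT, hilbertT, Complex.conj_tsum, ← (Equiv.neg ℤ).tsum_eq]
  refine tsum_congr fun n => ?_
  simp only [Equiv.neg_apply, map_mul, hcoeff, map_neg, Complex.conj_I, map_intCast,
    Int.sign_neg]
  rw [← fourier_neg, neg_neg n]
  push_cast
  ring

/-- `H(e^{it∂ₓ²}φ conj(e^{it∂ₓ²}ψ))` expanded over the frequencies of `φ`: the Hilbert symbol is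
absorbed into the coefficients of `ψ`. -/
theorem hilbertT_schrodingerEvol_mul_conj {c d : ℤ → ℂ} {s u : Finset ℤ}
    (hc : ∀ n ∉ s, c n = 0) (hd : ∀ n ∉ u, d n = 0) (t : ℝ) (x : AddCircle (2 * Real.pi)) :
    hilbertT (fun y => schrodingerEvol c t y * conj (schrodingerEvol d t y)) x =
      ∑ n ∈ s, (c n * Complex.exp (-Complex.I * (n : ℂ) ^ 2 * (t : ℂ)) * fourier n x) *
        conj (schrodingerEvol
          (fun k => (Complex.I * ((Int.sign (n - k) : ℤ) : ℂ)) * d k) t x) := by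
  have h : (fun y => schrodingerEvol c t y * conj (schrodingerEvol d t y)) = fun y =>
      ∑ p ∈ s ×ˢ u, ((c p.1 * Complex.exp (-Complex.I * (p.1 : ℂ) ^ 2 * (t : ℂ))) *
        conj (d p.2 * Complex.exp (-Complex.I * (p.2 : ℂ) ^ 2 * (t : ℂ)))) *
          fourier (p.1 - p.2) y := by
    ext y
    rw [schrodingerEvol_eq_sum hc, schrodingerEvol_eq_sum hd, map_sum, Finset.sum_mul_sum,
      Finset.sum_product]
    refine Finset.sum_congr rfl fun n _ => Finset.sum_congr rfl fun k _ => ?_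
    rw [sub_eq_add_neg, fourier_add, fourier_neg, map_mul _ (_ * _)]
    ring
  rw [h, hilbertT_sum_mul_fourier, Finset.sum_product]
  refine Finset.sum_congr rfl fun n _ => ?_
  rw [schrodingerEvol_eq_sum (s := u) fun k hk => by simp [hd k hk], map_sum, Finset.mul_sum]
  refine Finset.sum_congr rfl fun k _ => ?_
  rw [sub_eq_add_neg, fourier_add, fourier_neg]
  simp only [map_mul, Complex.conj_I, map_intCast]
  ring

theorem continuous_schrodingerEvol {c : ℤ → ℂ} {s : Finset ℤ} (hc : ∀ n ∉ s, c n = 0) (t : ℝ) :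
    Continuous (schrodingerEvol c t) := by
  have : schrodingerEvol c t = fun x =>
      ∑ n ∈ s, c n * Complex.exp (-Complex.I * (n : ℂ) ^ 2 * (t : ℂ)) * fourier n x :=
    funext fun x => schrodingerEvol_eq_sum hc t x
  rw [this]
  fun_prop

/-- Cauchy-Schwarz over the frequencies of the second factor, integrated in space. -/
theorem integral_norm_sq_mul_hilbertT_le {c₁ c₂ c₃ : ℤ → ℂ} {s₁ s₂ s₃ : Finset ℤ}
    (h₁ : ∀ n ∉ s₁, c₁ n = 0) (h₂ : ∀ n ∉ s₂, c₂ n = 0) (h₃ : ∀ n ∉ s₃, c₃ n = 0) (t : ℝ) :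
    ∫ x, ‖schrodingerEvol c₁ t x * hilbertT (fun y => schrodingerEvol c₂ t y *
        conj (schrodingerEvol c₃ t y)) x‖ ^ 2 ≤
      (∑ n ∈ s₂, ‖c₂ n‖ ^ 2) * ∑ n ∈ s₂, ∫ x, ‖schrodingerEvol c₁ t x * conj (schrodingerEvol
        (fun k => (Complex.I * ((Int.sign (n - k) : ℤ) : ℂ)) * c₃ k) t x)‖ ^ 2 := by
  have hd : ∀ n : ℤ, ∀ k ∉ s₃, (Complex.I * ((Int.sign (n - k) : ℤ) : ℂ)) * c₃ k = 0 :=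
    fun n k hk => by simp [h₃ k hk]
  have hint : ∀ n ∈ s₂, Integrable (fun x => ‖schrodingerEvol c₁ t x * conj (schrodingerEvol
        (fun k => (Complex.I * ((Int.sign (n - k) : ℤ) : ℂ)) * c₃ k) t x)‖ ^ 2) := by
    intro n _
    have hu := continuous_schrodingerEvol h₁ t
    have hv := continuous_schrodingerEvol (hd n) t
    exact Continuous.integrable_of_hasCompactSupport
      ((hu.mul (Complex.continuous_conj.comp hv)).norm.pow 2) (HasCompactSupport.of_compactSpace _)
  rw [← integral_finsetSum _ hint, ← integral_const_mul]
  refine integral_mono_of_nonneg (.of_forall fun x => by positivity)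
    ((integrable_finsetSum _ hint).const_mul _) (.of_forall fun x => ?_)
  simp only
  rw [hilbertT_schrodingerEvol_mul_conj h₂ h₃, Finset.mul_sum]
  refine le_trans ?_ (Finset.sum_mul_sq_le_sq_mul_sq s₂ (fun n => ‖c₂ n‖) _)
  gcongr
  refine (norm_sum_le _ _).trans_eq (Finset.sum_congr rfl fun n _ => ?_)
  have hf : ‖(fourier n x : ℂ)‖ = 1 := Circle.norm_coe _
  simp only [norm_mul, norm_exp_neg_I_mul_sq_mul, hf]
  ring

/-- The trilinear estimate with a loss given by the number of frequencies of the second factor. -/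
theorem integral_norm_sq_mul_hilbertT_le_card {c₁ c₂ c₃ : ℤ → ℂ} {s₁ s₂ s₃ : Finset ℤ}
    (h₁ : ∀ n ∉ s₁, c₁ n = 0) (h₂ : ∀ n ∉ s₂, c₂ n = 0) (h₃ : ∀ n ∉ s₃, c₃ n = 0)
    {N δ : ℝ} (hN : 0 < N)
    (hlow : ∀ n ∈ s₁, ∀ k ∈ s₃, N / 4 ≤ |((n - k : ℤ) : ℝ)|)
    (hup : ∀ n ∈ s₁, ∀ k ∈ s₃, |((n - k : ℤ) : ℝ)| ≤ 3 * N) (hδ : 0 ≤ δ) (hδN : δ ≤ N⁻¹) :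
    ∫ t in (0:ℝ)..δ, ∫ x, ‖schrodingerEvol c₁ t x * hilbertT (fun y => schrodingerEvol c₂ t y *
        conj (schrodingerEvol c₃ t y)) x‖ ^ 2 ≤
      8 * Real.pi ^ 2 * (#s₂ / N) * (∑ n ∈ s₁, ‖c₁ n‖ ^ 2) * (∑ n ∈ s₂, ‖c₂ n‖ ^ 2) *
        ∑ n ∈ s₃, ‖c₃ n‖ ^ 2 := by
  have hd : ∀ n : ℤ, ∀ k ∉ s₃, (Complex.I * ((Int.sign (n - k) : ℤ) : ℂ)) * c₃ k = 0 :=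
    fun n k hk => by simp [h₃ k hk]
  have hcont := fun n => continuous_integral_norm_sq_schrodingerEvol_mul_conj h₁ (hd n)
  have hsign : ∀ n k : ℤ, ‖(Complex.I * ((Int.sign (n - k) : ℤ) : ℂ)) * c₃ k‖ ≤ ‖c₃ k‖ := by
    intro n k
    rw [norm_mul, norm_mul, Complex.norm_I, one_mul]
    refine mul_le_of_le_one_left (norm_nonneg _) ?_
    rcases Int.sign_trichotomy (n - k) with h | h | h <;> simp [h]
  calc _ ≤ ∫ t in (0:ℝ)..δ, (∑ n ∈ s₂, ‖c₂ n‖ ^ 2) * ∑ n ∈ s₂, ∫ x, ‖schrodingerEvol c₁ t x *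
          conj (schrodingerEvol
            (fun k => (Complex.I * ((Int.sign (n - k) : ℤ) : ℂ)) * c₃ k) t x)‖ ^ 2 := by
        rw [intervalIntegral.integral_of_le hδ, intervalIntegral.integral_of_le hδ]
        refine integral_mono_of_nonneg (.of_forall fun t => integral_nonneg fun x => by positivity)
          ?_ (.of_forall fun t => integral_norm_sq_mul_hilbertT_le h₁ h₂ h₃ t)
        exact (continuous_const.mul (continuous_finsetSum _ fun n _ => hcont n)).integrableOn_Ioc
    _ = (∑ n ∈ s₂, ‖c₂ n‖ ^ 2) * ∑ n ∈ s₂, ∫ t in (0:ℝ)..δ, ∫ x, ‖schrodingerEvol c₁ t x *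
          conj (schrodingerEvol
            (fun k => (Complex.I * ((Int.sign (n - k) : ℤ) : ℂ)) * c₃ k) t x)‖ ^ 2 := by
        rw [intervalIntegral.integral_const_mul, intervalIntegral.integral_finsetSum
          fun n _ => (hcont n).intervalIntegrable _ _]
    _ ≤ (∑ n ∈ s₂, ‖c₂ n‖ ^ 2) * ∑ n ∈ s₂, 8 * Real.pi ^ 2 / N * (∑ n ∈ s₁, ‖c₁ n‖ ^ 2) *
          ∑ k ∈ s₃, ‖c₃ k‖ ^ 2 := by
        gcongr with n hn
        refine (integral_norm_sq_schrodingerEvol_mul_conj_le h₁ (hd n) hN hlow hup hδ hδN).trans ?_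
        gcongr with k hk
        exact hsign n k
    _ = _ := by
        rw [Finset.sum_const, nsmul_eq_mul]
        ring

/-- Complex conjugation exchanges the two factors inside the Hilbert transform. -/
theorem norm_mul_hilbertT_swap (z : ℂ) (f g : AddCircle (2 * Real.pi) → ℂ)
    (x : AddCircle (2 * Real.pi)) :
    ‖z * hilbertT (fun y => f y * conj (g y)) x‖ = ‖z * hilbertT (fun y => g y * conj (f y)) x‖ := by
  rw [norm_mul, norm_mul, ← RCLike.norm_conj (hilbertT _ x), conj_hilbertT]
  simp only [map_mul, Complex.conj_conj, mul_comm]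

/-- A finite set of integers in `[-2N, 2N]` has at most `5N` elements. -/
theorem card_le_of_abs_le {s : Finset ℤ} {k : ℕ} (hs : ∀ n ∈ s, |(n : ℝ)| ≤ 2 * 2 ^ k) :
    (#s : ℝ) ≤ 5 * 2 ^ k := by
  have hsub : s ⊆ Finset.Icc (-(2 * 2 ^ k : ℤ)) (2 * 2 ^ k) := by
    intro n hn
    have h := abs_le.mp (hs n hn)
    rw [Finset.mem_Icc]
    exact ⟨by exact_mod_cast h.1, by exact_mod_cast h.2⟩
  have h1 := Finset.card_le_card hsub
  rw [Int.card_Icc] at h1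
  have h2 : (1 : ℤ) ≤ 2 ^ k := one_le_pow₀ (by norm_num)
  have h3 : (#s : ℤ) ≤ 5 * 2 ^ k := by omega
  exact_mod_cast h3

theorem finite_setOf_ne_zero_of_abs_le (c : ℤ → ℂ) {R : ℝ} (hc : ∀ n : ℤ, c n ≠ 0 → |(n : ℝ)| ≤ R) :
    {n : ℤ | c n ≠ 0}.Finite := by
  refine (Set.finite_Icc (-⌈R⌉) ⌈R⌉).subset fun n hn => ?_
  have h := (abs_le.mp ((hc n hn).trans (Int.le_ceil R)))
  exact ⟨by exact_mod_cast h.1, by exact_mod_cast h.2⟩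

/-- Modified trilinear Strichartz estimate with the Hilbert transform: for dyadic `N₁ ≫ N₂, N₃`
and `0 < δ ≲ N₁⁻¹`,
`‖e^{it∂ₓ²}φ₁ · H(e^{it∂ₓ²}φ₂ conj(e^{it∂ₓ²}φ₃))‖_{L²([0,δ];L²(𝕋))}
   ≲ (min(N₂,N₃)/N₁)^{1/2} ∏‖φⱼ‖_{L²}` (squared form). -/
theorem stmt14 :
    ∃ C₀ > (0:ℝ), ∃ C > (0:ℝ), ∀ k₁ k₂ k₃ : ℕ,
      let N₁ : ℝ := 2 ^ k₁
      let N₂ : ℝ := 2 ^ k₂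
      let N₃ : ℝ := 2 ^ k₃
      C₀ * N₂ ≤ N₁ → C₀ * N₃ ≤ N₁ →
      ∀ c₁ c₂ c₃ : ℤ → ℂ,
      Summable (fun n => ‖c₁ n‖) → Summable (fun n => ‖c₂ n‖) → Summable (fun n => ‖c₃ n‖) →
      (∀ n : ℤ, c₁ n ≠ 0 → |(n : ℝ)| ≤ 2 * N₁ ∧ (N₁ ≤ 1 ∨ N₁ / 2 ≤ |(n : ℝ)|)) →
      (∀ n : ℤ, c₂ n ≠ 0 → |(n : ℝ)| ≤ 2 * N₂ ∧ (N₂ ≤ 1 ∨ N₂ / 2 ≤ |(n : ℝ)|)) →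
      (∀ n : ℤ, c₃ n ≠ 0 → |(n : ℝ)| ≤ 2 * N₃ ∧ (N₃ ≤ 1 ∨ N₃ / 2 ≤ |(n : ℝ)|)) →
      ∀ δ : ℝ, 0 < δ → δ ≤ N₁⁻¹ →
      (∫ t in (0:ℝ)..δ, ∫ x : AddCircle (2 * Real.pi),
          ‖schrodingerEvol c₁ t x *
            hilbertT (fun y => schrodingerEvol c₂ t y *
              (starRingEnd ℂ) (schrodingerEvol c₃ t y)) x‖ ^ 2)
        ≤ C * (min N₂ N₃ / N₁) *
            (∑' n : ℤ, ‖c₁ n‖ ^ 2) * (∑' n : ℤ, ‖c₂ n‖ ^ 2) * (∑' n : ℤ, ‖c₃ n‖ ^ 2) := by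
  refine ⟨8, by norm_num, 40 * Real.pi ^ 2, by positivity, ?_⟩
  intro k₁ k₂ k₃ N₁ N₂ N₃ h12 h13 c₁ c₂ c₃ _ _ _ hc₁ hc₂ hc₃ δ hδ hδN
  have hfin₁ := finite_setOf_ne_zero_of_abs_le c₁ fun n hn => (hc₁ n hn).1
  have hfin₂ := finite_setOf_ne_zero_of_abs_le c₂ fun n hn => (hc₂ n hn).1
  have hfin₃ := finite_setOf_ne_zero_of_abs_le c₃ fun n hn => (hc₃ n hn).1
  have hz₁ : ∀ n ∉ hfin₁.toFinset, c₁ n = 0 := fun n hn => by simpa using hn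
  have hz₂ : ∀ n ∉ hfin₂.toFinset, c₂ n = 0 := fun n hn => by simpa using hn
  have hz₃ : ∀ n ∉ hfin₃.toFinset, c₃ n = 0 := fun n hn => by simpa using hn
  have hN₁ : 0 < N₁ := by positivity
  have hN₂ : 1 ≤ N₂ := one_le_pow₀ (by norm_num)
  have hsep : ∀ N : ℝ, 8 * N ≤ N₁ → ∀ n k : ℤ, c₁ n ≠ 0 → |(k : ℝ)| ≤ 2 * N →
      N₁ / 4 ≤ |((n - k : ℤ) : ℝ)| ∧ |((n - k : ℤ) : ℝ)| ≤ 3 * N₁ := by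
    intro N hN n k hn hk
    obtain ⟨hup, hlow⟩ := hc₁ n hn
    have hlow' : N₁ / 2 ≤ |(n : ℝ)| := hlow.resolve_left (by linarith)
    have h1 := abs_sub_abs_le_abs_sub (n : ℝ) k
    have h2 := abs_sub (n : ℝ) k
    push_cast
    constructor <;> linarith
  rw [tsum_eq_sum (s := hfin₁.toFinset) fun n hn => by simp [hz₁ n hn],
    tsum_eq_sum (s := hfin₂.toFinset) fun n hn => by simp [hz₂ n hn],
    tsum_eq_sum (s := hfin₃.toFinset) fun n hn => by simp [hz₃ n hn]]
  rcases le_total N₂ N₃ with h | h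
  · rw [min_eq_left h]
    have hs : ∀ n ∈ hfin₁.toFinset, ∀ k ∈ hfin₃.toFinset, _ := fun n hn k hk =>
      hsep N₃ h13 n k (by simpa using hn) (hc₃ k (by simpa using hk)).1
    have hcard := card_le_of_abs_le (s := hfin₂.toFinset) (k := k₂)
      fun n hn => (hc₂ n (by simpa using hn)).1
    refine (integral_norm_sq_mul_hilbertT_le_card hz₁ hz₂ hz₃ hN₁ (fun n hn k hk => (hs n hn k hk).1)
      (fun n hn k hk => (hs n hn k hk).2) hδ.le hδN).trans ?_
    calc _ ≤ 8 * Real.pi ^ 2 * (5 * N₂ / N₁) * (∑ n ∈ hfin₁.toFinset, ‖c₁ n‖ ^ 2) *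
          (∑ n ∈ hfin₂.toFinset, ‖c₂ n‖ ^ 2) * ∑ n ∈ hfin₃.toFinset, ‖c₃ n‖ ^ 2 := by gcongr
      _ = _ := by ring
  · rw [min_eq_right h]
    simp_rw [norm_mul_hilbertT_swap _ (schrodingerEvol c₂ _)]
    have hs : ∀ n ∈ hfin₁.toFinset, ∀ k ∈ hfin₂.toFinset, _ := fun n hn k hk =>
      hsep N₂ h12 n k (by simpa using hn) (hc₂ k (by simpa using hk)).1
    have hcard := card_le_of_abs_le (s := hfin₃.toFinset) (k := k₃)
      fun n hn => (hc₃ n (by simpa using hn)).1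
    refine (integral_norm_sq_mul_hilbertT_le_card hz₁ hz₃ hz₂ hN₁ (fun n hn k hk => (hs n hn k hk).1)
      (fun n hn k hk => (hs n hn k hk).2) hδ.le hδN).trans ?_
    calc _ ≤ 8 * Real.pi ^ 2 * (5 * N₃ / N₁) * (∑ n ∈ hfin₁.toFinset, ‖c₁ n‖ ^ 2) *
          (∑ n ∈ hfin₃.toFinset, ‖c₃ n‖ ^ 2) * ∑ n ∈ hfin₂.toFinset, ‖c₂ n‖ ^ 2 := by gcongr
      _ = _ := by ring
end

section
/- For the one-dimensional periodic Schrödinger group, the frequency-truncated kernel satisfies the short-time dispersive bound: for every dyadic N ≥ 1, 0 < |t| ≤ N⁻¹ and x ∈ 𝕋, |Σ_{ξ ∈ ℤ} η(ξ/N) e^{ixξ - itξ²}| ≲ |t|^{-1/2}, with an implicit constant independent of N, t, x. Consequently ‖P_{≤N} e^{it∂ₓ²}φ‖_{L^∞(𝕋)} ≲ |t|^{-1/2} ‖φ‖_{L¹(𝕋)} for 0 < |t| ≤ N⁻¹. -/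
open MeasureTheory

/-- A `C²` function of compact support has first differences `O(s)` and second differences
`O(s²)`. -/
lemma exists_bound_differences {f : ℝ → ℝ} (hf : ContDiff ℝ 2 f) (hc : HasCompactSupport f) :
    ∃ A : ℝ, 0 ≤ A ∧ ∀ s : ℝ, 0 ≤ s → ∀ y,
      |f (y + s) - f y| ≤ A * s ∧ |f (y + s) - 2 * f y + f (y - s)| ≤ A * s ^ 2 := by
  have h1 : ContDiff ℝ 1 (deriv f) := by
    have : ContDiff ℝ (1 + 1) f := by simpa [one_add_one_eq_two] using hf
    exact this.deriv'
  have hd : Differentiable ℝ f := hf.differentiable (by norm_num)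
  have hd1 : Differentiable ℝ (deriv f) := h1.differentiable (by norm_num)
  obtain ⟨A₁, hA₁⟩ := hc.deriv.exists_bound_of_continuous h1.continuous
  obtain ⟨A₂, hA₂⟩ := hc.deriv.deriv.exists_bound_of_continuous (h1.continuous_deriv le_rfl)
  have lip : ∀ {g : ℝ → ℝ} {A : ℝ}, Differentiable ℝ g → (∀ x, ‖deriv g x‖ ≤ A) →
      ∀ x y, ‖g y - g x‖ ≤ A * ‖y - x‖ := fun {g A} hg hA x y =>
    Convex.norm_image_sub_le_of_norm_deriv_le (fun z _ => hg z) (fun z _ => hA z)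
      convex_univ (Set.mem_univ x) (Set.mem_univ y)
  refine ⟨max (max A₁ A₂) 0, le_max_right _ _, fun s hs y => ⟨?_, ?_⟩⟩
  · have := lip hd hA₁ y (y + s)
    rw [add_sub_cancel_left, Real.norm_eq_abs, Real.norm_eq_abs, abs_of_nonneg hs] at this
    refine this.trans (mul_le_mul_of_nonneg_right ?_ hs)
    exact (le_max_left _ _).trans (le_max_left _ _)
  · have hG : ∀ x, HasDerivAt (fun x => f (x + s) - f x) (deriv f (x + s) - deriv f x) x :=
      fun x => ((hd (x + s)).hasDerivAt.comp_add_const x s).sub (hd x).hasDerivAt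
    have hGb : ∀ x, ‖deriv (fun x => f (x + s) - f x) x‖ ≤ A₂ * s := fun x => by
      rw [(hG x).deriv]
      have := lip hd1 hA₂ x (x + s)
      rwa [add_sub_cancel_left, Real.norm_eq_abs s, abs_of_nonneg hs] at this
    have := lip (fun x => (hG x).differentiableAt) hGb (y - s) y
    rw [sub_sub_cancel, Real.norm_eq_abs, Real.norm_eq_abs s, abs_of_nonneg hs] at this
    have h2 : A₂ ≤ max (max A₁ A₂) 0 := (le_max_right _ _).trans (le_max_left _ _)
    calc |f (y + s) - 2 * f y + f (y - s)|
        = |f (y + s) - f y - (f (y - s + s) - f (y - s))| := by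
          rw [sub_add_cancel]; congr 1; ring
      _ ≤ A₂ * s * s := this
      _ = A₂ * s ^ 2 := by ring
      _ ≤ _ := by gcongr

/-- Second differences of a product of two sequences. -/
lemma abs_second_difference_mul_le {u₀ u₁ u₂ v₀ v₁ v₂ P Q : ℝ}
    (hu : |u₁| ≤ 1) (hv : |v₁| ≤ 1)
    (hu2 : |u₂ - 2 * u₁ + u₀| ≤ Q) (hv2 : |v₂ - 2 * v₁ + v₀| ≤ Q)
    (hu01 : |u₁ - u₀| ≤ P) (hu12 : |u₂ - u₁| ≤ P)
    (hv01 : |v₁ - v₀| ≤ P) (hv12 : |v₂ - v₁| ≤ P) :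
    |u₂ * v₂ - 2 * (u₁ * v₁) + u₀ * v₀| ≤ 2 * Q + 2 * P ^ 2 := by
  have hQ : 0 ≤ Q := (abs_nonneg _).trans hu2
  have hP : 0 ≤ P := (abs_nonneg _).trans hu01
  have e : u₂ * v₂ - 2 * (u₁ * v₁) + u₀ * v₀ = (u₂ - 2 * u₁ + u₀) * v₁
      + u₁ * (v₂ - 2 * v₁ + v₀) + (u₂ - u₁) * (v₂ - v₁) + (u₁ - u₀) * (v₁ - v₀) := by ring
  have m : ∀ {a b c d : ℝ}, |a| ≤ c → |b| ≤ d → |a * b| ≤ c * d := fun {a b c d} ha hb => by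
    rw [abs_mul]; exact mul_le_mul ha hb (abs_nonneg _) ((abs_nonneg _).trans ha)
  have b1 := m hu2 hv
  have b2 := m hu hv2
  have b3 := m hu12 hv12
  have b4 := m hu01 hv01
  rw [e]
  refine (abs_add_le _ _).trans ?_
  refine (add_le_add_left (abs_add_le _ _) _).trans ?_
  refine (add_le_add_left (add_le_add_left (abs_add_le _ _) _) _).trans ?_
  linarith

/-- A norm bound for a sum over `ℤ` of terms vanishing off `[-K, K]`. -/
lemma norm_tsum_int_le {f : ℤ → ℂ} {K : ℕ} {D : ℝ} (hf : ∀ n : ℤ, (K : ℤ) < |n| → f n = 0)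
    (hD : ∀ n, ‖f n‖ ≤ D) : ‖∑' n, f n‖ ≤ (2 * K + 1) * D := by
  rw [tsum_eq_sum (s := Finset.Icc (-(K : ℤ)) K) (fun n hn => hf n (by
    rw [Finset.mem_Icc, ← abs_le, not_le] at hn; exact hn))]
  refine (norm_sum_le_of_le _ fun n _ => hD n).trans (le_of_eq ?_)
  rw [Finset.sum_const, Int.card_Icc, nsmul_eq_mul,
    show ((K : ℤ) + 1 - -(K : ℤ)).toNat = 2 * K + 1 by omega]
  push_cast; ring

lemma summable_int_of_support {f : ℤ → ℂ} {K : ℕ} (hf : ∀ n : ℤ, (K : ℤ) < |n| → f n = 0) :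
    Summable f :=
  summable_of_ne_finset_zero (s := Finset.Icc (-(K : ℤ)) K) (fun n hn => hf n (by
    rw [Finset.mem_Icc, ← abs_le, not_le] at hn; exact hn))

/-- Two summations by parts. -/
lemma norm_tsum_mul_exp_mul_sq_le {w : ℤ → ℝ} {K : ℕ} {D : ℝ}
    (hw : ∀ n : ℤ, (K : ℤ) < |n| → w n = 0)
    (hD : ∀ n, |w (n + 1) - 2 * w n + w (n - 1)| ≤ D) (θ : ℝ) :
    ‖∑' n : ℤ, (w n : ℂ) * Complex.exp (Complex.I * (θ * n))‖
        * ‖Complex.exp (Complex.I * θ) - 1‖ ^ 2 ≤ (2 * K + 3) * D := by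
  set E : ℤ → ℂ := fun n => Complex.exp (Complex.I * (θ * n)) with hE
  have hEn : ∀ n, ‖E n‖ = 1 := fun n => by
    rw [hE]
    simpa using Complex.norm_exp_I_mul_ofReal (θ * n)
  have hadd : ∀ m n, E (m + n) = E m * E n := fun m n => by
    simp only [hE, ← Complex.exp_add]; congr 1; push_cast; ring
  have hE0 : E 0 = 1 := by simp [hE]
  have hE1 : Complex.exp (Complex.I * θ) = E 1 := by simp [hE]
  have hS : Summable fun n => (w n : ℂ) * E n :=
    summable_int_of_support (K := K) fun n hn => by simp [hw n hn]
  have shift : ∀ j : ℤ, HasSum (fun n => (w (n + j) : ℂ) * E n)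
      (E (-j) * ∑' n, (w n : ℂ) * E n) := fun j => by
    have h := ((Equiv.addRight j).hasSum_iff.2 hS.hasSum).mul_left (E (-j))
    refine h.congr_fun fun n => ?_
    simp only [Function.comp, Equiv.coe_addRight]
    have h1 : E (-j) * E j = 1 := by rw [← hadd]; simp [hE0]
    rw [hadd n j]
    linear_combination (-((w (n + j) : ℂ) * E n)) * h1
  have key := ((shift 1).sub ((shift 0).mul_left 2)).add (shift (-1))
  have hT : (∑' n, (w n : ℂ) * E n) * (E 1 - 1) ^ 2
      = E 1 * ∑' n, (((w (n + 1) - 2 * w n + w (n - 1) : ℝ)) : ℂ) * E n := by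
    have e : (∑' n, (((w (n + 1) - 2 * w n + w (n - 1) : ℝ)) : ℂ) * E n) = _ :=
      (key.congr_fun fun n => by
        rw [add_zero, ← sub_eq_add_neg]; push_cast; ring).tsum_eq
    rw [e]
    have h1 : E 1 * E (-1) = 1 := by rw [← hadd]; simp [hE0]
    simp only [neg_zero, neg_neg, hE0]
    linear_combination (-(∑' n, (w n : ℂ) * E n)) * h1
  rw [hE1, ← norm_pow, ← norm_mul, hT, norm_mul, hEn, one_mul]
  have := norm_tsum_int_le (K := K + 1) (D := D)
    (f := fun n => (((w (n + 1) - 2 * w n + w (n - 1) : ℝ)) : ℂ) * E n) ?_ ?_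
  · push_cast at this ⊢
    linarith
  · intro n hn
    push_cast at hn
    rw [hw n, hw (n + 1), hw (n - 1)]
    · simp
    all_goals rw [lt_abs] at *; omega
  · intro n
    rw [norm_mul, hEn, mul_one, Complex.norm_real]
    exact hD n

/-- `∑ₕ (1 + s²(h - a)²)⁻¹` over a finite range is `O(1/s)`, by comparison with `arctan`. -/
lemma sum_inv_one_add_sq_le {s : ℝ} (hs : 0 < s) (hs1 : s ≤ 1) (a : ℝ) (m : ℕ) :
    ∑ i ∈ Finset.range m, (1 + s ^ 2 * (i - a) ^ 2)⁻¹ ≤ 3 * Real.pi / s := by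
  have step : ∀ i : ℕ, (1 + s ^ 2 * (i - a) ^ 2)⁻¹ ≤
      3 / s * Real.arctan (s * ((i + 1 : ℕ) - a)) - 3 / s * Real.arctan (s * (i - a)) := by
    intro i
    obtain ⟨c, hc, hc'⟩ := exists_hasDerivAt_eq_slope (fun y : ℝ => Real.arctan (s * (y - a)))
      (fun y => (1 / (1 + (s * (y - a)) ^ 2)) * (s * 1)) (show (i : ℝ) < i + 1 by linarith)
      (by fun_prop)
      (fun y _ => ((hasDerivAt_id y).sub_const a |>.const_mul s).arctan)
    rw [add_sub_cancel_left, div_one] at hc'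
    push_cast
    rw [← mul_sub, ← hc']
    have : 1 + (s * (c - a)) ^ 2 ≤ 3 * (1 + s ^ 2 * (i - a) ^ 2) := by
      have h1 : (c - a) ^ 2 ≤ 2 * (i - a) ^ 2 + 2 := by
        nlinarith [sq_nonneg ((i - a) - (c - i)), hc.1, hc.2]
      have h2 : s ^ 2 ≤ 1 := by nlinarith
      nlinarith [mul_le_mul_of_nonneg_left h1 (sq_nonneg s),
        mul_nonneg (sq_nonneg s) (sq_nonneg ((i : ℝ) - a))]
    rw [show 3 / s * (1 / (1 + (s * (c - a)) ^ 2) * (s * 1)) = 3 / (1 + (s * (c - a)) ^ 2) by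
      field_simp, inv_eq_one_div, div_le_div_iff₀ (by positivity) (by positivity)]
    linarith
  refine (Finset.sum_le_sum fun i _ => step i).trans ?_
  rw [Finset.sum_range_sub (fun i : ℕ => 3 / s * Real.arctan (s * (i - a))), ← mul_sub, mul_comm 3,
    mul_div_assoc, mul_comm]
  gcongr
  rw [Nat.cast_zero]
  linarith [Real.arctan_lt_pi_div_two (s * (m - a)),
    Real.neg_pi_div_two_lt_arctan (s * (0 - a))]

/-- `e^{iθ}` is close to `1` only near `2πℤ`. -/
lemma exists_int_le_norm_exp_sub_one {θ : ℝ} (hθ : |θ| ≤ 3 * Real.pi) :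
    ∃ j ∈ ({-1, 0, 1} : Finset ℤ),
      2 / Real.pi * |θ - 2 * Real.pi * j| ≤ ‖Complex.exp (Complex.I * θ) - 1‖ := by
  have main : ∀ j : ℤ, |θ - 2 * Real.pi * j| ≤ Real.pi →
      2 / Real.pi * |θ - 2 * Real.pi * j| ≤ ‖Complex.exp (Complex.I * θ) - 1‖ := by
    intro j hj
    have e : Complex.exp (Complex.I * θ)
        = Complex.exp (Complex.I * ((θ - 2 * Real.pi * j : ℝ) : ℂ)) := by
      rw [Complex.exp_eq_exp_iff_exists_int]
      exact ⟨j, by push_cast; ring⟩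
    rw [e, Complex.norm_exp_I_mul_ofReal_sub_one, norm_mul, Real.norm_eq_abs, Real.norm_eq_abs]
    have := Real.mul_abs_le_abs_sin (x := (θ - 2 * Real.pi * j) / 2) (by
      rw [abs_div, abs_two]; linarith)
    rw [abs_div, abs_two] at this
    rw [abs_two]
    linarith
  rw [abs_le] at hθ
  rcases le_total θ (-Real.pi) with h | h
  · exact ⟨-1, by simp, main _ (abs_le.2 (by push_cast; constructor <;> linarith))⟩
  rcases le_total θ Real.pi with h' | h'
  · exact ⟨0, by simp, main _ (abs_le.2 (by push_cast; constructor <;> linarith))⟩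
  · exact ⟨1, by simp, main _ (abs_le.2 (by push_cast; constructor <;> linarith))⟩

/-- The correlations produced by squaring the kernel decay away from `2πℤ`. -/
lemma norm_correlation_mul_le {u : ℤ → ℝ} {N : ℕ} (hN : 1 ≤ N) {A : ℝ}
    (hsupp : ∀ n : ℤ, ((2 * N : ℕ) : ℤ) < |n| → u n = 0) (hu : ∀ n, |u n| ≤ 1)
    (hu1 : ∀ n, |u (n + 1) - u n| ≤ A * (N : ℝ)⁻¹)
    (hu2 : ∀ n, |u (n + 1) - 2 * u n + u (n - 1)| ≤ A * (N : ℝ)⁻¹ ^ 2) (h : ℤ) (θ : ℝ) :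
    ‖∑' n : ℤ, ((u n * u (n + h) : ℝ) : ℂ) * Complex.exp (Complex.I * (θ * n))‖
        * (1 + N ^ 2 * ‖Complex.exp (Complex.I * θ) - 1‖ ^ 2)
      ≤ N * (5 + 14 * A + 14 * A ^ 2) := by
  have hN' : (1 : ℝ) ≤ N := by exact_mod_cast hN
  have hA : 0 ≤ A := by
    have := (abs_nonneg _).trans (hu1 0)
    exact nonneg_of_mul_nonneg_left this (by positivity)
  have hw : ∀ n : ℤ, ((2 * N : ℕ) : ℤ) < |n| → u n * u (n + h) = 0 := fun n hn => by
    rw [hsupp n hn, zero_mul]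
  have b1 := norm_tsum_int_le (K := 2 * N) (D := 1)
    (f := fun n : ℤ => ((u n * u (n + h) : ℝ) : ℂ) * Complex.exp (Complex.I * (θ * n)))
    (fun n hn => by simp only [hw n hn, Complex.ofReal_zero, zero_mul]) (fun n => by
      have := Complex.norm_exp_I_mul_ofReal (θ * n)
      push_cast at this
      rw [norm_mul, this, mul_one, Complex.norm_real, norm_mul]
      exact mul_le_one₀ (hu n) (norm_nonneg _) (hu _))
  have b2 := norm_tsum_mul_exp_mul_sq_le hw (D := 2 * (A * (N : ℝ)⁻¹ ^ 2) + 2 * (A * (N : ℝ)⁻¹) ^ 2)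
    (fun n => by
      have e1 : n + 1 + h = n + h + 1 := by ring
      have e2 : n - 1 + h = n + h - 1 := by ring
      have d1 := hu1 (n - 1)
      have d2 := hu1 (n + h - 1)
      rw [sub_add_cancel] at d1 d2
      rw [e1, e2]
      exact abs_second_difference_mul_le (hu n) (hu _) (hu2 n) (hu2 _) d1 (hu1 n) d2 (hu1 _)) θ
  set T := ‖∑' n : ℤ, ((u n * u (n + h) : ℝ) : ℂ) * Complex.exp (Complex.I * (θ * n))‖
  set d := ‖Complex.exp (Complex.I * θ) - 1‖
  push_cast at b1 b2
  have b3 : T * (N ^ 2 * d ^ 2) ≤ (4 * N + 3) * (2 * A + 2 * A ^ 2) := by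
    calc T * (N ^ 2 * d ^ 2) = N ^ 2 * (T * d ^ 2) := by ring
      _ ≤ N ^ 2 * ((2 * (2 * N) + 3) *
          (2 * (A * (N : ℝ)⁻¹ ^ 2) + 2 * (A * (N : ℝ)⁻¹) ^ 2)) := by gcongr
      _ = (4 * N + 3) * (2 * A + 2 * A ^ 2) := by field_simp; ring
  have b4 : (4 * (N : ℝ) + 3) * (2 * A + 2 * A ^ 2) ≤ 7 * N * (2 * A + 2 * A ^ 2) := by
    gcongr; linarith
  nlinarith

/-- Summing the correlation bound over all shifts. -/
lemma sum_le_of_mul_le {N : ℕ} (hN : 1 ≤ N) {t : ℝ} (ht : t ≠ 0) (htN : |t| ≤ (N : ℝ)⁻¹)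
    {B : ℝ} (hB : 0 ≤ B) {T : ℤ → ℝ}
    (hT : ∀ h, T h * (1 + N ^ 2 * ‖Complex.exp (Complex.I * (-2 * t * h : ℝ)) - 1‖ ^ 2) ≤ N * B) :
    ∑ h ∈ Finset.Icc (-((4 * N : ℕ) : ℤ)) (4 * N : ℕ), T h ≤ 9 * Real.pi * B / |t| := by
  have hN' : (1 : ℝ) ≤ N := by exact_mod_cast hN
  have ht' : 0 < |t| := abs_pos.2 ht
  have hs : 0 < N * |t| := by positivity
  have hs1 : N * |t| ≤ 1 := by
    calc N * |t| ≤ N * (N : ℝ)⁻¹ := by gcongr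
      _ = 1 := by field_simp
  have point : ∀ h ∈ Finset.Icc (-((4 * N : ℕ) : ℤ)) (4 * N : ℕ), T h ≤
      N * B * ∑ j ∈ ({-1, 0, 1} : Finset ℤ),
        (1 + (N * |t|) ^ 2 * (h - -(Real.pi * j / t)) ^ 2)⁻¹ := by
    intro h hh
    have hh' : |(h : ℝ)| ≤ 4 * N := by
      rw [Finset.mem_Icc, ← abs_le] at hh
      exact_mod_cast hh
    obtain ⟨j, hj, hle⟩ := exists_int_le_norm_exp_sub_one (θ := -2 * t * h) (by
      rw [abs_mul, abs_mul, abs_neg, abs_two]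
      calc 2 * |t| * |(h : ℝ)| ≤ 2 * |t| * (4 * N) := by gcongr
        _ = 8 * (N * |t|) := by ring
        _ ≤ 3 * Real.pi := by linarith [Real.pi_gt_three])
    have hsq := pow_le_pow_left₀ (by positivity) hle 2
    have low : (N * |t|) ^ 2 * (h - -(Real.pi * j / t)) ^ 2
        ≤ N ^ 2 * ‖Complex.exp (Complex.I * (-2 * t * h : ℝ)) - 1‖ ^ 2 := by
      rw [mul_pow, mul_assoc]
      refine mul_le_mul_of_nonneg_left (le_trans ?_ hsq) (by positivity)
      have e : (2 / Real.pi * |-2 * t * h - 2 * Real.pi * j|) ^ 2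
          = (16 / Real.pi ^ 2) * (t ^ 2 * (h - -(Real.pi * j / t)) ^ 2) := by
        rw [mul_pow, sq_abs]
        field_simp
        ring
      rw [e, sq_abs]
      refine le_mul_of_one_le_left (by positivity) ?_
      rw [one_le_div (by positivity)]
      nlinarith [Real.pi_pos, Real.pi_le_four]
    have h1 : T h ≤ N * B * (1 + (N * |t|) ^ 2 * (h - -(Real.pi * j / t)) ^ 2)⁻¹ := by
      rcases le_total (T h) 0 with h0 | h0
      · exact h0.trans (by positivity)
      · rw [← div_eq_mul_inv, le_div_iff₀ (by positivity)]
        exact (mul_le_mul_of_nonneg_left (by linarith) h0).trans (hT h)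
    refine h1.trans (mul_le_mul_of_nonneg_left ?_ (by positivity))
    exact Finset.single_le_sum
      (f := fun j : ℤ => (1 + (N * |t|) ^ 2 * (h - -(Real.pi * j / t)) ^ 2)⁻¹)
      (fun _ _ => by positivity) hj
  have hsum : ∀ a : ℝ, ∑ h ∈ Finset.Icc (-((4 * N : ℕ) : ℤ)) (4 * N : ℕ),
      (1 + (N * |t|) ^ 2 * (h - a) ^ 2)⁻¹ ≤ 3 * Real.pi / (N * |t|) := by
    intro a
    refine le_trans (le_of_eq ?_) (sum_inv_one_add_sq_le hs hs1 (a + 4 * N) (8 * N + 1))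
    rw [Int.Icc_eq_finset_map, Finset.sum_map,
      show (((4 * N : ℕ) : ℤ) + 1 - -((4 * N : ℕ) : ℤ)).toNat = 8 * N + 1 by omega]
    refine Finset.sum_congr rfl fun i _ => ?_
    simp only [Function.Embedding.trans_apply, Nat.castEmbedding_apply, addLeftEmbedding_apply]
    push_cast
    ring_nf
  refine (Finset.sum_le_sum point).trans ?_
  rw [← Finset.mul_sum, Finset.sum_comm]
  calc N * B * ∑ j ∈ ({-1, 0, 1} : Finset ℤ), ∑ h ∈ Finset.Icc (-((4 * N : ℕ) : ℤ)) (4 * N : ℕ),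
        (1 + (N * |t|) ^ 2 * (h - -(Real.pi * j / t)) ^ 2)⁻¹
      ≤ N * B * ∑ j ∈ ({-1, 0, 1} : Finset ℤ), 3 * Real.pi / (N * |t|) := by
        gcongr
        exact hsum _
    _ = 9 * Real.pi * B / |t| := by
        rw [Finset.sum_const, show Finset.card ({-1, 0, 1} : Finset ℤ) = 3 by decide]
        simp only [nsmul_eq_mul]
        field_simp
        ring

/-- Squaring a sum over `ℤ` and collecting terms according to the shift. -/
lemma mul_conj_tsum_eq {c : ℤ → ℂ} {K : ℕ} (hc : ∀ n : ℤ, (K : ℤ) < |n| → c n = 0) :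
    (∑' n, c n) * starRingEnd ℂ (∑' n, c n) =
      ∑ h ∈ Finset.Icc (-((2 * K : ℕ) : ℤ)) (2 * K : ℕ),
        ∑' n, c (n + h) * starRingEnd ℂ (c n) := by
  have hF : ∀ n ∉ Finset.Icc (-(K : ℤ)) K, c n = 0 := fun n hn => hc n (by
    rw [Finset.mem_Icc, ← abs_le, not_le] at hn; exact hn)
  have inner : ∀ n ∈ Finset.Icc (-(K : ℤ)) K, ∑' m, c m =
      ∑ h ∈ Finset.Icc (-((2 * K : ℕ) : ℤ)) (2 * K : ℕ), c (n + h) := by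
    intro n hn
    rw [← (Equiv.addLeft n).tsum_eq c]
    refine tsum_eq_sum fun h hh => hF _ ?_
    simp only [Finset.mem_Icc, Equiv.coe_addLeft] at *
    omega
  conv_lhs => rw [show starRingEnd ℂ (∑' n, c n) = _ from
    congrArg _ (tsum_eq_sum (f := c) (fun n hn => hF n hn)), map_sum, Finset.mul_sum]
  rw [Finset.sum_congr rfl fun n hn => by rw [inner n hn, Finset.sum_mul], Finset.sum_comm]
  refine Finset.sum_congr rfl fun h _ => (tsum_eq_sum fun n hn => ?_).symm
  rw [hF n hn, map_zero, mul_zero]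

/-- The dispersive bound for a quadratic exponential sum with smooth weights. -/
lemma norm_tsum_quadratic_sq_le {u : ℤ → ℝ} {N : ℕ} (hN : 1 ≤ N) {A : ℝ}
    (hsupp : ∀ n : ℤ, ((2 * N : ℕ) : ℤ) < |n| → u n = 0) (hu : ∀ n, |u n| ≤ 1) (hA : 0 ≤ A)
    (hu1 : ∀ n, |u (n + 1) - u n| ≤ A * (N : ℝ)⁻¹)
    (hu2 : ∀ n, |u (n + 1) - 2 * u n + u (n - 1)| ≤ A * (N : ℝ)⁻¹ ^ 2)
    {t : ℝ} (ht : t ≠ 0) (htN : |t| ≤ (N : ℝ)⁻¹) (x : ℝ) :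
    ‖∑' n : ℤ, (u n : ℂ) * Complex.exp (Complex.I * ((x : ℂ) * (n : ℂ) - (t : ℂ) * (n : ℂ) ^ 2))‖
        ^ 2 ≤ 9 * Real.pi * (5 + 14 * A + 14 * A ^ 2) / |t| := by
  set c : ℤ → ℂ := fun n =>
    (u n : ℂ) * Complex.exp (Complex.I * ((x : ℂ) * (n : ℂ) - (t : ℂ) * (n : ℂ) ^ 2)) with hc
  have hcs : ∀ n : ℤ, ((2 * N : ℕ) : ℤ) < |n| → c n = 0 := fun n hn => by
    simp only [hc, hsupp n hn, Complex.ofReal_zero, zero_mul]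
  have hterm : ∀ h n : ℤ, c (n + h) * starRingEnd ℂ (c n) =
      Complex.exp (Complex.I * ((x * h - t * h ^ 2 : ℝ) : ℂ)) *
        (((u n * u (n + h) : ℝ) : ℂ) *
          Complex.exp (Complex.I * (((-2 * t * h : ℝ) : ℂ) * n))) := by
    intro h n
    simp only [hc, map_mul, Complex.conj_ofReal, ← Complex.exp_conj, map_sub, map_pow,
      Complex.conj_I, map_intCast]
    rw [mul_mul_mul_comm, ← Complex.exp_add, mul_left_comm, ← Complex.exp_add]
    push_cast
    rw [mul_comm (u n : ℂ)]
    congr 2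
    ring
  have hnorm : ‖∑' n, c n‖ ^ 2 = ‖(∑' n, c n) * starRingEnd ℂ (∑' n, c n)‖ := by
    rw [norm_mul, RCLike.norm_conj, sq]
  rw [hnorm, mul_conj_tsum_eq hcs]
  refine (norm_sum_le _ _).trans ?_
  have := sum_le_of_mul_le hN ht htN (B := 5 + 14 * A + 14 * A ^ 2) (by positivity)
    fun h => norm_correlation_mul_le hN hsupp hu hu1 hu2 h (-2 * t * h)
  rw [show 2 * (2 * N) = 4 * N by ring]
  refine le_trans (le_of_eq (Finset.sum_congr rfl fun h _ => ?_)) this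
  rw [tsum_congr (hterm h), tsum_mul_left, norm_mul, Complex.norm_exp_I_mul_ofReal, one_mul]

/-- Summing a Fourier series against finitely many multipliers is convolution with the kernel. -/
lemma norm_tsum_mul_fourierCoeff_le {T : ℝ} [hT : Fact (0 < T)] {a : ℤ → ℂ} {K : ℕ}
    (ha : ∀ n : ℤ, (K : ℤ) < |n| → a n = 0) {M : ℝ}
    (hM : ∀ y : AddCircle T, ‖∑' n, a n * fourier n y‖ ≤ M)
    {φ : AddCircle T → ℂ} (hφ : Integrable φ AddCircle.haarAddCircle) (x : AddCircle T) :
    ‖∑' n, a n * fourierCoeff φ n * fourier n x‖ ≤ M * ∫ y, ‖φ y‖ ∂AddCircle.haarAddCircle := by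
  have hF : ∀ n ∉ Finset.Icc (-(K : ℤ)) K, a n = 0 := fun n hn => ha n (by
    rw [Finset.mem_Icc, ← abs_le, not_le] at hn; exact hn)
  have hint : ∀ n : ℤ, Integrable (fun y => fourier (-n) y • φ y) AddCircle.haarAddCircle :=
    fun n => hφ.bdd_mul (c := 1) (by fun_prop) (ae_of_all _ fun y => by
      rw [fourier_apply, Circle.norm_coe])
  have e : ∑' n, a n * fourierCoeff φ n * fourier n x
      = ∫ y, (∑' n, a n * fourier n (x - y)) * φ y ∂AddCircle.haarAddCircle := by
    rw [tsum_eq_sum (s := Finset.Icc (-(K : ℤ)) K) fun n hn => by rw [hF n hn]; ring]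
    have : ∀ y, (∑' n, a n * fourier n (x - y)) * φ y = ∑ n ∈ Finset.Icc (-(K : ℤ)) K,
        (a n * fourier n x) * (fourier (-n) y • φ y) := fun y => by
      rw [tsum_eq_sum (s := Finset.Icc (-(K : ℤ)) K) fun n hn => by rw [hF n hn]; ring,
        Finset.sum_mul]
      refine Finset.sum_congr rfl fun n _ => ?_
      have : (fourier n (x - y) : ℂ) = fourier n x * fourier (-n) y := by
        simp only [fourier_apply, smul_add, smul_neg, neg_smul, sub_eq_add_neg, AddCircle.toCircle_add,
          Circle.coe_mul]
      rw [this, smul_eq_mul]; ring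
    simp only [this]
    rw [integral_finsetSum _ fun n _ => (hint n).const_mul _]
    refine Finset.sum_congr rfl fun n _ => ?_
    rw [integral_const_mul, fourierCoeff]
    ring
  rw [e, ← integral_const_mul]
  refine norm_integral_le_of_norm_le (hφ.norm.const_mul M) (ae_of_all _ fun y => ?_)
  rw [norm_mul]
  gcongr
  exact hM _

/-- Short-time dispersive estimate for the frequency-truncated periodic Schrödinger group:
for dyadic `N = 2^k` and `0 < |t| ≤ N⁻¹`, the kernel satisfies
`|Σ_{ξ∈ℤ} η(ξ/N) e^{i(xξ - tξ²)}| ≲ |t|^{-1/2}`, and consequently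
`‖P_{≤N} e^{it∂ₓ²}φ‖_{L^∞(𝕋)} ≲ |t|^{-1/2} ‖φ‖_{L¹(𝕋)}`. -/
theorem stmt19 (η : ℝ → ℝ) (hη_smooth : ContDiff ℝ (⊤ : ℕ∞) η) (hη_even : ∀ x, η (-x) = η x)
    (hη_one : ∀ x : ℝ, |x| ≤ 4 / 3 → η x = 1) (hη_nonneg : ∀ x, 0 ≤ η x)
    (hη_le : ∀ x, η x ≤ 1) (hη_supp : ∀ x : ℝ, 5 / 3 < |x| → η x = 0) :
    ∃ C > (0:ℝ), ∀ k : ℕ,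
      let N : ℝ := 2 ^ k
      ∀ t : ℝ, t ≠ 0 → |t| ≤ N⁻¹ →
      (∀ x : ℝ, ‖∑' ξ : ℤ, ((η ((ξ : ℝ) / N) : ℝ) : ℂ) *
            Complex.exp (Complex.I * ((x : ℂ) * (ξ : ℂ) - (t : ℂ) * (ξ : ℂ) ^ 2))‖
          ≤ C * |t| ^ (-(1:ℝ) / 2)) ∧
      (∀ φ : AddCircle (2 * Real.pi) → ℂ, Integrable φ →
        ∀ x : AddCircle (2 * Real.pi),
          ‖∑' n : ℤ, ((η ((n : ℝ) / N) : ℝ) : ℂ) *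
              Complex.exp (-Complex.I * (n : ℂ) ^ 2 * (t : ℂ)) * fourierCoeff φ n * fourier n x‖
            ≤ C * |t| ^ (-(1:ℝ) / 2) * ∫ y : AddCircle (2 * Real.pi), ‖φ y‖) := by
  have hc : HasCompactSupport η :=
    HasCompactSupport.intro (isCompact_Icc (a := (-(5 / 3) : ℝ)) (b := 5 / 3)) fun x hx =>
      hη_supp x (by rwa [Set.mem_Icc, ← abs_le, not_le] at hx)
  obtain ⟨A, hA, hdiff⟩ := exists_bound_differences
    (hη_smooth.of_le (WithTop.coe_le_coe.2 (le_top : (2 : ℕ∞) ≤ ⊤))) hc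
  set R : ℝ := 9 * Real.pi * (5 + 14 * A + 14 * A ^ 2) with hR
  have hRpos : 0 < R := by positivity
  refine ⟨√R, Real.sqrt_pos.2 hRpos, ?_⟩
  intro k N t ht htN
  have hNpos : 0 < N := by positivity
  have hNcast : ((2 ^ k : ℕ) : ℝ) = N := by push_cast; rfl
  have hsupp : ∀ n : ℤ, ((2 * 2 ^ k : ℕ) : ℤ) < |n| → η ((n : ℝ) / N) = 0 := fun n hn => by
    have hn' : ((2 * 2 ^ k : ℕ) : ℝ) < |(n : ℝ)| := by exact_mod_cast hn
    rw [Nat.cast_mul, hNcast, Nat.cast_two] at hn'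
    refine hη_supp _ ?_
    rw [abs_div, abs_of_pos hNpos, lt_div_iff₀ hNpos]
    linarith
  have hNinv : 0 ≤ N⁻¹ := by positivity
  have hsucc : ∀ n : ℤ, (((n + 1 : ℤ) : ℝ) / N) = n / N + N⁻¹ := fun n => by
    push_cast; ring
  have hpred : ∀ n : ℤ, (((n - 1 : ℤ) : ℝ) / N) = n / N - N⁻¹ := fun n => by
    push_cast; ring
  have kernel : ∀ x : ℝ, ‖∑' ξ : ℤ, ((η ((ξ : ℝ) / N) : ℝ) : ℂ) *
      Complex.exp (Complex.I * ((x : ℂ) * (ξ : ℂ) - (t : ℂ) * (ξ : ℂ) ^ 2))‖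
        ≤ √R * |t| ^ (-(1 : ℝ) / 2) := by
    intro x
    have h := norm_tsum_quadratic_sq_le (u := fun n => η ((n : ℝ) / N)) (N := 2 ^ k)
      Nat.one_le_two_pow hsupp (fun n => by rw [abs_of_nonneg (hη_nonneg _)]; exact hη_le _) hA
      (fun n => by rw [hNcast, hsucc]; exact (hdiff _ hNinv _).1)
      (fun n => by rw [hNcast, hsucc, hpred]; exact (hdiff _ hNinv _).2)
      ht (by rwa [hNcast]) x
    rw [neg_div, Real.rpow_neg (abs_nonneg t), ← Real.sqrt_eq_rpow, ← div_eq_mul_inv,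
      ← Real.sqrt_div hRpos.le]
    exact Real.le_sqrt_of_sq_le h
  refine ⟨kernel, fun φ hφ x => ?_⟩
  have hφ' : Integrable φ AddCircle.haarAddCircle := by
    rw [AddCircle.volume_eq_smul_haarAddCircle] at hφ
    exact (integrable_smul_measure (by simp [Real.pi_pos]) ENNReal.ofReal_ne_top).1 hφ
  have hbound := norm_tsum_mul_fourierCoeff_le (K := 2 * 2 ^ k)
    (a := fun n : ℤ => ((η ((n : ℝ) / N) : ℝ) : ℂ) *
      Complex.exp (-Complex.I * (n : ℂ) ^ 2 * (t : ℂ)))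
    (fun n hn => by simp only [hsupp n hn, Complex.ofReal_zero, zero_mul])
    (M := √R * |t| ^ (-(1 : ℝ) / 2)) (fun y => by
      induction y using QuotientAddGroup.induction_on with
      | H y =>
        refine le_trans (le_of_eq ?_) (kernel y)
        congr 1
        refine tsum_congr fun n => ?_
        rw [fourier_coe_apply, mul_assoc, ← Complex.exp_add]
        congr 2
        have : (Real.pi : ℂ) ≠ 0 := by exact_mod_cast Real.pi_ne_zero
        push_cast
        field_simp
        ring) hφ' x
  refine hbound.trans (mul_le_mul_of_nonneg_left ?_ (by positivity))
  rw [AddCircle.volume_eq_smul_haarAddCircle, integral_smul_measure,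
    ENNReal.toReal_ofReal (by positivity), smul_eq_mul]
  refine le_mul_of_one_le_left (integral_nonneg fun _ => norm_nonneg _) ?_
  linarith [Real.pi_gt_three]
end
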